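/- arXiv:1711.01706 — 2 statements merged into one kernel-verified Lean document; each statement's English description precedes it below -/
import Mathlib

section
/- For every ε > 0 there exists a bound p₀(ε) such that for every prime p ≡ 1 (mod 3) with p > p₀(ε), the number of primes q < p^{1/2+ε} that are cubic residues modulo p exceeds p^{ε/30}. -/
abbrev EisInt := QuadraticAlgebra ℤ (-1) (-1)

noncomputable def eisLift {K : Type*} [CommRing K] (w : K) (hw : w * w = -1 - w) : EisInt →+* K :=
  (QuadraticAlgebra.lift (R := ℤ) (a := -1) (b := -1) ⟨w, by rw [hw]; simp; ring⟩).toRingHom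

lemma eisLift_apply {K : Type*} [CommRing K] (w : K) (hw : w * w = -1 - w) (z : EisInt) :
    eisLift w hw z = z.re + z.im * w := by
  simp [eisLift, QuadraticAlgebra.lift]

@[simp] lemma eis_one_re : (1 : EisInt).re = 1 := rfl
@[simp] lemma eis_one_im : (1 : EisInt).im = 0 := rfl

instance eisDomain : IsDomain EisInt := by
  have : NoZeroDivisors EisInt := by
    constructor
    intro x y hxy
    have h0 : ∀ z : EisInt, z.norm = 0 → z = 0 := by
      intro z hz
      rw [QuadraticAlgebra.norm_def] at hz
      have h1 : z.im = 0 := by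
        by_contra h
        have := pow_two_pos_of_ne_zero h
        nlinarith [sq_nonneg (2 * z.re - z.im)]
      have h2 : z.re = 0 := by
        rw [h1] at hz
        simpa using hz
      ext <;> simp [h1, h2]
    have h1 : x.norm * y.norm = 0 := by rw [← map_mul, hxy]; simp
    rcases mul_eq_zero.mp h1 with h | h
    · exact Or.inl (h0 _ h)
    · exact Or.inr (h0 _ h)
  exact NoZeroDivisors.to_isDomain _

lemma eis_omega_prim : IsPrimitiveRoot (QuadraticAlgebra.omega : EisInt) 3 := by
  have h1 : (QuadraticAlgebra.omega : EisInt) ^ 3 = 1 := by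
    ext <;> simp [pow_succ]
  have : Fact (Nat.Prime 3) := ⟨Nat.prime_three⟩
  rw [IsPrimitiveRoot.iff_orderOf]
  refine orderOf_eq_prime h1 ?_
  intro h
  have := congrArg QuadraticAlgebra.im h
  simp at this

lemma prim3_rel {K : Type*} [CommRing K] [IsDomain K] {w : K} (hw : IsPrimitiveRoot w 3) :
    w * w = -1 - w := by
  have h1 : (w - 1) * (w * w + w + 1) = 0 := by
    linear_combination hw.pow_eq_one
  have h2 : w - 1 ≠ 0 := sub_ne_zero.mpr (hw.ne_one (by norm_num))
  linear_combination (mul_eq_zero.mp h1).resolve_left h2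

lemma eisLift_injOn {K : Type*} [CommRing K] [IsDomain K] {w : K} (hw : IsPrimitiveRoot w 3)
    {z : EisInt} (hz : z ^ 3 = 1) (h : eisLift w (prim3_rel hw) z = 1) : z = 1 := by
  obtain ⟨i, hi, rfl⟩ := eis_omega_prim.eq_pow_of_pow_eq_one hz
  rw [map_pow, eisLift_apply] at h
  simp at h
  have := (hw.pow_eq_one_iff_dvd i).mp h
  interval_cases i <;> simp_all

/-- The Jacobi sum data. -/
lemma jacobi_norm (p : ℕ) [Fact p.Prime] (χ : MulChar (ZMod p) EisInt) (hχ : orderOf χ = 3) :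
    (jacobiSum χ χ).re ^ 2 - (jacobiSum χ χ).re * (jacobiSum χ χ).im + (jacobiSum χ χ).im ^ 2 = p := by
  obtain ⟨w, hw⟩ : ∃ w : ℂ, IsPrimitiveRoot w 3 := ⟨_, Complex.isPrimitiveRoot_exp 3 (by norm_num)⟩
  set f := eisLift w (prim3_rel hw)
  have hcube : ∀ u : (ZMod p)ˣ, (χ u) ^ 3 = 1 := by
    intro u
    rw [← MulChar.pow_apply_coe, ← hχ, pow_orderOf_eq_one]
    simp
  have hne : χ.ringHomComp f ≠ 1 := by
    intro h
    have : χ = 1 := by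
      refine MulChar.ext fun u => ?_
      have h1 : χ.ringHomComp f u = 1 := by rw [h]; simp
      simp only [MulChar.ringHomComp_apply] at h1
      simpa using eisLift_injOn hw (hcube u) h1
    rw [this] at hχ
    simp at hχ
  have hne2 : χ.ringHomComp f * χ.ringHomComp f ≠ 1 := by
    intro h
    apply hne
    have h3 : χ.ringHomComp f ^ 3 = 1 := by
      ext u
      rw [MulChar.pow_apply_coe, MulChar.ringHomComp_apply, ← map_pow, hcube u]
      simp
    calc χ.ringHomComp f = χ.ringHomComp f ^ 3 * (χ.ringHomComp f * χ.ringHomComp f)⁻¹ := by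
          group
      _ = 1 := by rw [h, h3]; simp
  have key := jacobiSum_mul_jacobiSum_inv (F := ZMod p) (F' := ℂ) (by
    rw [ZMod.ringChar_zmod_n, ringChar.eq_zero]
    exact (Fact.out : p.Prime).ne_zero.symm) hne hne hne2
  have hc : jacobiSum (χ.ringHomComp f)⁻¹ (χ.ringHomComp f)⁻¹ =
      starRingEnd ℂ (jacobiSum (χ.ringHomComp f) (χ.ringHomComp f)) := by
    rw [jacobiSum, jacobiSum, map_sum]
    refine Finset.sum_congr rfl fun x _ => ?_
    rw [map_mul, ← MulChar.star_apply', ← MulChar.star_apply']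
    rfl
  rw [hc, jacobiSum_ringHomComp, eisLift_apply, ZMod.card] at key
  have hconj : starRingEnd ℂ w = -1 - w := by
    have h1 : starRingEnd ℂ w = w⁻¹ := by
      have : ‖w‖ = 1 := hw.norm'_eq_one (by norm_num)
      rw [Complex.inv_def, Complex.normSq_eq_norm_sq, this]; simp
    rw [h1, ← prim3_rel hw]
    have := hw.ne_zero (by norm_num)
    field_simp
    exact hw.pow_eq_one.symm
  rw [map_add, map_mul, hconj] at key
  simp only [map_intCast] at key
  have hr := prim3_rel hw
  have : (((jacobiSum χ χ).re ^ 2 - (jacobiSum χ χ).re * (jacobiSum χ χ).im + (jacobiSum χ χ).im ^ 2 : ℤ) : ℂ) = ((p:ℤ):ℂ) := by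
    push_cast
    linear_combination key + (jacobiSum χ χ).im ^ 2 * hr
  exact_mod_cast this

lemma jacobi_cong (p : ℕ) [Fact p.Prime] (hp : p % 3 = 1) (χ : MulChar (ZMod p) EisInt) (hχ : orderOf χ = 3) :
    (jacobiSum χ χ).re % 3 = 2 ∧ (3:ℤ) ∣ (jacobiSum χ χ).im := by
  have h3 : χ ^ 3 = 1 := by rw [← hχ, pow_orderOf_eq_one]
  obtain ⟨z, -, hz⟩ := exists_jacobiSum_eq_neg_one_add (n := 3) (by norm_num) h3 h3 
    (by rw [ZMod.card]; have := (Fact.out : p.Prime).pos; omega) eis_omega_prim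
  rw [hz]
  constructor
  · simp [pow_two]
  · simp [pow_two]

lemma cube_of_char (p : ℕ) [Fact p.Prime] {K : Type*} [Field K] (χ : MulChar (ZMod p) K)
    (hχ : orderOf χ = 3) (u : (ZMod p)ˣ) (hu : χ u = 1) : ∃ z : ZMod p, z ^ 3 = u := by
  obtain ⟨g, hg⟩ := IsCyclic.exists_generator (α := (ZMod p)ˣ)
  obtain ⟨k, rfl⟩ := hg u
  have h3 : (χ g) ^ 3 = 1 := by
    rw [← MulChar.pow_apply_coe, ← hχ, pow_orderOf_eq_one]; simp
  have h1 : χ g ≠ 1 := by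
    intro h
    have : χ = 1 := by
      refine MulChar.ext fun u => ?_
      obtain ⟨k, rfl⟩ := hg u
      have : (χ.toUnitHom (g ^ k)) = 1 := by
        rw [map_zpow]
        have : χ.toUnitHom g = 1 := by ext; simpa using h
        rw [this]; simp
      have := congrArg Units.val this
      rw [MulChar.coe_toUnitHom] at this
      rw [this, MulChar.one_apply_coe]; simp
    rw [this] at hχ
    simp at hχ
  have ho : orderOf (χ.toUnitHom g) = 3 := by
    have : Fact (Nat.Prime 3) := ⟨Nat.prime_three⟩
    refine orderOf_eq_prime ?_ ?_
    · ext; simpa using h3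
    · intro h; apply h1; simpa using congrArg Units.val h
  have h2 : (χ.toUnitHom g) ^ k = 1 := by
    rw [← map_zpow]; ext; rw [MulChar.coe_toUnitHom]; simpa using hu
  obtain ⟨m, rfl⟩ := orderOf_dvd_iff_zpow_eq_one.mpr h2
  refine ⟨((g ^ m : (ZMod p)ˣ) : ZMod p), ?_⟩
  rw [ho, ← Units.val_pow_eq_pow_val]
  congr 1
  simp only [← zpow_natCast, ← zpow_mul]
  congr 1; push_cast; ring

lemma orderOf_ringHomComp_eis {p : ℕ} [Fact p.Prime] {K : Type*} [Field K] {w : K}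
    (hw : IsPrimitiveRoot w 3) (χ : MulChar (ZMod p) EisInt) (hχ : orderOf χ = 3) :
    orderOf (χ.ringHomComp (eisLift w (prim3_rel hw))) = 3 := by
  have hcube : ∀ u : (ZMod p)ˣ, (χ u) ^ 3 = 1 := by
    intro u
    rw [← MulChar.pow_apply_coe, ← hχ, pow_orderOf_eq_one]
    simp
  have : Fact (Nat.Prime 3) := ⟨Nat.prime_three⟩
  refine orderOf_eq_prime ?_ ?_
  · refine MulChar.ext fun u => ?_
    rw [MulChar.pow_apply_coe, MulChar.ringHomComp_apply, ← map_pow, hcube u]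
    simp
  · intro h
    have : χ = 1 := by
      refine MulChar.ext fun u => ?_
      have h1 : χ.ringHomComp (eisLift w (prim3_rel hw)) u = 1 := by rw [h]; simp
      simp only [MulChar.ringHomComp_apply] at h1
      simpa using eisLift_injOn hw (hcube u) h1
    rw [this] at hχ
    simp at hχ

lemma cubic_recip_aux (K : Type) [Field K] (p q : ℕ) [Fact p.Prime] [Fact q.Prime] [CharP K q] (w ζ : K)
    (hw : IsPrimitiveRoot w 3) (hζ : IsPrimitiveRoot ζ p) (hq3 : q ≠ 3) (hpq : q ≠ p)
    (χ : MulChar (ZMod p) EisInt) (hχ : orderOf χ = 3) (a b x y : ℤ)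
    (hJ : jacobiSum χ χ = ⟨a, b⟩) (hn : a ^ 2 - a * b + b ^ 2 = p)
    (hy : ¬ (q : ℤ) ∣ y)
    (hdvd : (q : ℤ) ∣ b * (x ^ 3 + y ^ 3 - 3 * x * y ^ 2) - a * (3 * x ^ 2 * y - 3 * x * y ^ 2)) :
    ∃ z : ZMod p, z ^ 3 = q := by
  have h3K : NeZero ((3 : ℕ) : K) := by
    refine ⟨fun h => hq3 ?_⟩
    rw [CharP.cast_eq_zero_iff K q] at h
    exact (Nat.prime_dvd_prime_iff_eq Fact.out Nat.prime_three).mp h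
  have hpK : NeZero ((p : ℕ) : K) := by
    refine ⟨fun h => hpq ?_⟩
    rw [CharP.cast_eq_zero_iff K q] at h
    exact (Nat.prime_dvd_prime_iff_eq Fact.out Fact.out).mp h
  have hr := prim3_rel hw
  set f := eisLift w hr with hf
  set χ' := χ.ringHomComp f with hχ'
  have ho : orderOf χ' = 3 := orderOf_ringHomComp_eis hw χ hχ
  have ho3 : χ' ^ 3 = 1 := by rw [← ho, pow_orderOf_eq_one]
  let ψ := AddChar.zmodChar p hζ.pow_eq_one
  have hψ : ψ.IsPrimitive := AddChar.zmodChar_primitive_of_primitive_root p hζ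
  set g := gaussSum χ' ψ with hg
  have hχ1 : χ' (-1) = 1 := by
    have h1 : χ' (-1) ^ 3 = 1 := by
      have : χ' (((-1 : (ZMod p)ˣ)) : ZMod p) ^ 3 = 1 := by
        rw [← MulChar.pow_apply_coe, ho3, MulChar.one_apply_coe]
      simpa using this
    have h2 : χ' (-1) ^ 2 = 1 := by rw [← map_pow]; simp
    calc χ' (-1) = χ' (-1) ^ 3 := by rw [pow_succ, h2, one_mul]
      _ = 1 := h1
  have hg3 : g ^ 3 = p * (a + b * w) := by
    have := gaussSum_pow_eq_prod_jacobiSum (χ := χ') (ψ := ψ) (by omega) hψ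
    rw [ho, hχ1, ZMod.card] at this
    rw [hg, this]
    have : Finset.Ico 1 (3 - 1) = {1} := rfl
    rw [this, Finset.prod_singleton, pow_one, hχ', jacobiSum_ringHomComp, hJ, hf, eisLift_apply]
    simp
  have hg0 : g ≠ 0 := gaussSum_ne_zero_of_nontrivial (by rw [ZMod.card]; exact hpK.out)
    (by intro h; rw [h] at ho; simp at ho) hψ
  -- Frobenius squared
  have hqu : IsUnit (q : ZMod p) := by
    rw [isUnit_iff_ne_zero]
    intro h
    rw [ZMod.natCast_eq_zero_iff] at h
    exact hpq ((Nat.prime_dvd_prime_iff_eq Fact.out Fact.out).mp h).symm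
  have hq2 : q ^ 2 % 3 = 1 := by
    have : q % 3 ≠ 0 := by
      intro h
      exact hq3 ((Nat.prime_dvd_prime_iff_eq Nat.prime_three Fact.out).mp (Nat.dvd_of_mod_eq_zero h)).symm
    have : q % 3 = 1 ∨ q % 3 = 2 := by omega
    rcases this with h | h <;> simp [Nat.pow_mod, h]
  have hpow3 : ∀ {M : Type} [Monoid M] (m : M), m ^ 3 = 1 → m ^ q ^ 2 = m := by
    intro M _ m hm
    rw [← Nat.div_add_mod (q ^ 2) 3, hq2, pow_add, pow_mul, hm]; simp
  have hfrob : χ' (q : ZMod p) ^ 2 * g ^ q ^ 2 = g := by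
    have h1 : g ^ q ^ 2 = gaussSum (χ' ^ q ^ 2) (ψ ^ q ^ 2) := by
      rw [pow_two, pow_mul, hg, gaussSum_frob, gaussSum_frob, ← pow_mul, ← pow_mul]
    have h2 : χ' ^ q ^ 2 = χ' := by
      rw [← Nat.div_add_mod (q ^ 2) 3, hq2, pow_add, pow_mul, ho3]; simp
    rw [h1, h2, AddChar.pow_mulShift, ← map_pow]
    have := gaussSum_mulShift χ' ψ (hqu.unit ^ 2)
    simpa using this
  have hF : ∀ z : K, z ^ q ^ 2 = iterateFrobenius K q 2 z := fun z => (iterateFrobenius_def q 2 z).symm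
  have hFw : iterateFrobenius K q 2 w = w := by
    rw [← hF, ← Nat.div_add_mod (q ^ 2) 3, hq2, pow_add, pow_mul, hw.pow_eq_one]; simp
  set J : K := a + b * w with hJd
  set J' : K := a + b * (-1 - w) with hJd'
  have hJJ : J * J' = p := by
    have : ((a ^ 2 - a * b + b ^ 2 : ℤ) : K) = ((p : ℤ) : K) := by rw [hn]
    push_cast at this
    rw [← this]
    linear_combination (-(b:K) ^ 2) * hr
  set u : K := x + y * w with hu
  set u' : K := x + y * (-1 - w) with hu'
  have hyK : (y : K) ≠ 0 := by
    rwa [Ne, CharP.intCast_eq_zero_iff K q]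
  have hJ0 : J ≠ 0 := by intro h; rw [h, zero_mul] at hJJ; exact hpK.out hJJ.symm
  have hJ0' : J' ≠ 0 := by intro h; rw [h, mul_zero] at hJJ; exact hpK.out hJJ.symm
  have hrel : J * u' ^ 3 = J' * u ^ 3 := by
    have h0 : ((b * (x ^ 3 + y ^ 3 - 3 * x * y ^ 2) - a * (3 * x ^ 2 * y - 3 * x * y ^ 2) : ℤ) : K) = 0 := by
      rwa [CharP.intCast_eq_zero_iff K q]
    push_cast at h0
    have e1 : u ^ 3 = (x ^ 3 + y ^ 3 - 3 * x * y ^ 2) + (3 * x ^ 2 * y - 3 * x * y ^ 2) * w := by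
      have h3 := hw.pow_eq_one
      rw [hu]
      linear_combination (y:K) ^ 3 * h3 + 3 * (x:K) * y ^ 2 * hr
    have e2 : u' ^ 3 = (x ^ 3 + y ^ 3 - 3 * x * y ^ 2) + (3 * x ^ 2 * y - 3 * x * y ^ 2) * (-1 - w) := by
      have h3 := hw.pow_eq_one
      rw [hu']
      linear_combination (-(y:K) ^ 3) * h3 + (3 * (x:K) * y ^ 2 - 3 * y ^ 3) * hr
    rw [e1, e2, hJd, hJd']
    linear_combination (1 + 2 * w) * h0
  have hu0 : u ≠ 0 := by
    intro h
    rw [h] at hrel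
    have h' : u' = 0 := by
      have : J * u' ^ 3 = 0 := by rw [hrel]; ring
      exact pow_eq_zero_iff (n := 3) (by norm_num) |>.mp ((mul_eq_zero.mp this).resolve_left hJ0)
    have h1 : (y : K) * (1 + 2 * w) = 0 := by
      have : u - u' = 0 := by rw [h, h']; ring
      rw [hu, hu'] at this
      linear_combination this
    have h2 := (mul_eq_zero.mp h1).resolve_left hyK
    apply h3K.out
    push_cast
    linear_combination (-(1 + 2 * w)) * h2 + 4 * hr
  have hc : g ^ 3 = (J * u' / u) ^ 3 := by
    rw [hg3, ← hJJ]
    rw [div_pow, eq_div_iff (pow_ne_zero 3 hu0)]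
    linear_combination (-(J ^ 2)) * hrel
  have hv0 : J * u' / u ≠ 0 := by
    intro h
    rw [h] at hc
    exact hg0 (by simpa using hc)
  have hd : (g / (J * u' / u)) ^ 3 = 1 := by
    rw [div_pow, hc, div_self]
    exact pow_ne_zero _ hv0
  obtain ⟨i, -, hi⟩ := hw.eq_pow_of_pow_eq_one hd
  have hgg : g = w ^ i * (J * u' / u) := by
    rw [hi, div_mul_cancel₀ _ hv0]
  have hgF : g ^ q ^ 2 = g := by
    rw [hF, hgg]
    simp [hJd, hu, hu', hFw]
  rw [hgF] at hfrob
  have h2 : χ' (q : ZMod p) ^ 2 = 1 := by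
    have : (χ' (q : ZMod p) ^ 2 - 1) * g = 0 := by linear_combination hfrob
    exact sub_eq_zero.mp ((mul_eq_zero.mp this).resolve_right hg0)
  have h3 : χ' (q : ZMod p) ^ 3 = 1 := by
    have : χ' (hqu.unit : ZMod p) ^ 3 = 1 := by
      rw [← MulChar.pow_apply_coe, ho3, MulChar.one_apply_coe]
    simpa using this
  have h1 : χ' (q : ZMod p) = 1 := by
    rw [pow_succ, h2, one_mul] at h3
    exact h3
  have := cube_of_char p χ' ho hqu.unit (by simpa using h1)
  simpa using this

lemma cubic_recip (p q : ℕ) [Fact p.Prime] [Fact q.Prime] (hq3 : q ≠ 3) (hpq : q ≠ p)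
    (χ : MulChar (ZMod p) EisInt) (hχ : orderOf χ = 3) (a b x y : ℤ)
    (hJ : jacobiSum χ χ = ⟨a, b⟩) (hn : a ^ 2 - a * b + b ^ 2 = p)
    (hy : ¬ (q : ℤ) ∣ y)
    (hdvd : (q : ℤ) ∣ b * (x ^ 3 + y ^ 3 - 3 * x * y ^ 2) - a * (3 * x ^ 2 * y - 3 * x * y ^ 2)) :
    ∃ z : ZMod p, z ^ 3 = q := by
  let K := AlgebraicClosure (ZMod q)
  have : CharP K q := inferInstance
  have h3K : NeZero ((3 : ℕ) : K) := by
    refine ⟨fun h => hq3 ?_⟩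
    rw [CharP.cast_eq_zero_iff K q] at h
    exact (Nat.prime_dvd_prime_iff_eq Fact.out Nat.prime_three).mp h
  have hpK : NeZero ((p : ℕ) : K) := by
    refine ⟨fun h => hpq ?_⟩
    rw [CharP.cast_eq_zero_iff K q] at h
    exact (Nat.prime_dvd_prime_iff_eq Fact.out Fact.out).mp h
  obtain ⟨w, hw⟩ : ∃ w : K, IsPrimitiveRoot w 3 := HasEnoughRootsOfUnity.exists_primitiveRoot K 3
  obtain ⟨ζ, hζ⟩ : ∃ ζ : K, IsPrimitiveRoot ζ p := HasEnoughRootsOfUnity.exists_primitiveRoot K p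
  exact cubic_recip_aux K p q w ζ hw hζ hq3 hpq χ hχ a b x y hJ hn hy hdvd

/-- The cubic form. -/
def cf (a b x y : ℤ) : ℤ := b * x ^ 3 - a * x ^ 2 * y + (a - 3 * b) * x * y ^ 2 + b * y ^ 3

theorem exists_form (p : ℕ) (hp : p.Prime) (hp3 : p % 3 = 1) :
    ∃ a b : ℤ, a ^ 2 - 3 * a * b + 9 * b ^ 2 = p ∧ a % 3 = 2 ∧
      ∀ q : ℕ, q.Prime → 5 ≤ q → q ≠ p → ∀ x y : ℤ, ¬ (q : ℤ) ∣ y → (q : ℤ) ∣ cf a b x y →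
        ∃ z : ℤ, z ^ 3 ≡ q [ZMOD p] := by
  have : Fact p.Prime := ⟨hp⟩
  obtain ⟨χ, hχ⟩ := MulChar.exists_mulChar_orderOf (ZMod p) (n := 3)
    (by rw [ZMod.card]; have := hp.pos; omega) eis_omega_prim
  obtain ⟨ha, b, hb⟩ := jacobi_cong p hp3 χ hχ
  have hn := jacobi_norm p χ hχ
  refine ⟨(jacobiSum χ χ).re, b, ?_, ha, ?_⟩
  · rw [hb] at hn; rw [← hn]; ring
  · intro q hq hq5 hqp x y hy hd
    have : Fact q.Prime := ⟨hq⟩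
    obtain ⟨z, hz⟩ := cubic_recip p q (by omega) hqp χ hχ (jacobiSum χ χ).re (jacobiSum χ χ).im x y rfl hn hy (by
      rw [hb]
      obtain ⟨c, hc⟩ := hd
      refine ⟨3 * c, ?_⟩
      rw [cf] at hc
      linear_combination 3 * hc)
    refine ⟨z.val, ?_⟩
    rw [← ZMod.intCast_eq_intCast_iff]
    simpa using hz
open Finset in
lemma mertens_upper (m : ℕ) (hm : 1 ≤ m) (S : Finset ℕ) (hS : ∀ q ∈ S, q.Prime ∧ q ≤ m) :
    ∑ q ∈ S, Real.log q / q ≤ Real.log m + Real.log 4 := by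
  have hm0 : (0:ℝ) < m := by exact_mod_cast hm
  have hfac : ∑ q ∈ S, ((m / q : ℕ) : ℝ) * Real.log q ≤ m * Real.log m := by
    have h1 : Real.log (m.factorial) = ∑ q ∈ m.factorial.primeFactors, (m.factorial.factorization q : ℝ) * Real.log q := by
      conv_lhs => rw [← Nat.prod_factorization_pow_eq_self (Nat.factorial_ne_zero m)]
      rw [Finsupp.prod, Nat.cast_prod, Real.log_prod]
      · simp
      · intro q hq
        have := (Nat.prime_of_mem_primeFactors (by simpa using hq)).pos
        positivity
    have h2 : Real.log (m.factorial) ≤ m * Real.log m := by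
      rw [← Real.log_pow]
      apply Real.log_le_log (by exact_mod_cast Nat.factorial_pos m)
      exact_mod_cast Nat.factorial_le_pow m
    refine le_trans ?_ h2
    rw [h1]
    have hsub : S ⊆ m.factorial.primeFactors := by
      intro q hq
      obtain ⟨hp, hle⟩ := hS q hq
      rw [Nat.mem_primeFactors]
      exact ⟨hp, (hp.dvd_factorial).mpr hle, Nat.factorial_ne_zero m⟩
    refine le_trans (sum_le_sum fun q hq => ?_) (sum_le_sum_of_subset_of_nonneg hsub fun q _ _ => ?_)
    · obtain ⟨hp, hle⟩ := hS q hq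
      have hlog : 0 ≤ Real.log q := Real.log_natCast_nonneg q
      refine mul_le_mul_of_nonneg_right ?_ hlog
      rw [Nat.factorization_factorial hp (b := Nat.log q m + 1) (by omega)]
      have : m / q ^ 1 ≤ ∑ i ∈ Ico 1 (Nat.log q m + 1), m / q ^ i := by
        refine single_le_sum (f := fun i => m / q ^ i) (fun _ _ => Nat.zero_le _) ?_
        simp only [mem_Ico, le_refl, true_and]
        have := Nat.log_pos hp.one_lt hle
        omega
      rw [pow_one] at this
      exact_mod_cast this
    · have hlog : 0 ≤ Real.log q := Real.log_natCast_nonneg q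
      positivity
  have htheta : ∑ q ∈ S, Real.log q ≤ Real.log 4 * m := by
    refine le_trans ?_ (Chebyshev.theta_le_log4_mul_x hm0.le)
    rw [Chebyshev.theta]
    refine sum_le_sum_of_subset_of_nonneg ?_ fun q _ _ => Real.log_natCast_nonneg q
    intro q hq
    obtain ⟨hp, hle⟩ := hS q hq
    simp [hp, hle, hp.pos]
  have h3 : m * ∑ q ∈ S, Real.log q / q ≤ m * (Real.log m + Real.log 4) := by
    calc m * ∑ q ∈ S, Real.log q / q ≤ ∑ q ∈ S, (((m / q : ℕ) : ℝ) * Real.log q + Real.log q) := by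
          rw [mul_sum]
          refine sum_le_sum fun q hq => ?_
          have hlog : 0 ≤ Real.log q := Real.log_natCast_nonneg q
          have hq0 : (0:ℝ) < q := by exact_mod_cast (hS q hq).1.pos
          have : (m:ℝ) / q ≤ ((m / q : ℕ) : ℝ) + 1 := by
            rw [div_le_iff₀ hq0]
            have := Nat.lt_div_mul_add (a := m) (hS q hq).1.pos
            have : m ≤ (m / q + 1) * q := by rw [add_mul, one_mul]; omega
            exact_mod_cast this
          calc (m:ℝ) * (Real.log q / q) = m / q * Real.log q := by ring
            _ ≤ (((m / q : ℕ) : ℝ) + 1) * Real.log q := by gcongr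
            _ = _ := by ring
      _ ≤ _ := by rw [sum_add_distrib]; linarith
  exact le_of_mul_le_mul_left h3 hm0

open Finset in
lemma sum_log_bound (m : ℕ) (hm : 3 ≤ m) (S : Finset ℕ) (hS : ∀ q ∈ S, q.Prime ∧ 5 ≤ q)
    (hcard : S.card ≤ m) :
    ∑ q ∈ S, Real.log q / (q - 1) ≤ 5 / 4 * (2 * Real.log m + Real.log 4) := by
  have hm0 : (0:ℝ) < m := by positivity
  have h1 : ∑ q ∈ S, Real.log q / (q - 1) ≤ 5 / 4 * ∑ q ∈ S, Real.log q / q := by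
    rw [mul_sum]
    refine sum_le_sum fun q hq => ?_
    have hq5 : (5:ℝ) ≤ q := by exact_mod_cast (hS q hq).2
    have hlog : 0 ≤ Real.log q := Real.log_natCast_nonneg q
    rw [← mul_div_assoc, div_le_div_iff₀ (by linarith) (by linarith)]
    nlinarith
  have h2 := mertens_upper m (by omega) (S.filter (· ≤ m)) (by
    intro q hq; rw [mem_filter] at hq; exact ⟨(hS q hq.1).1, hq.2⟩)
  have h3 : ∑ q ∈ S.filter (¬ · ≤ m), Real.log q / q ≤ Real.log m := by
    have he : Real.exp 1 ≤ m := by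
      have := Real.exp_one_lt_d9
      have : (3:ℝ) ≤ m := by exact_mod_cast hm
      linarith
    calc _ ≤ ∑ q ∈ S.filter (¬ · ≤ m), Real.log m / m := by
          refine sum_le_sum fun q hq => ?_
          rw [mem_filter] at hq
          have hle : (m:ℝ) ≤ q := by exact_mod_cast (not_le.mp hq.2).le
          exact Real.log_div_self_antitoneOn he (he.trans hle) hle
      _ = (S.filter (¬ · ≤ m)).card * (Real.log m / m) := by simp
      _ ≤ m * (Real.log m / m) := by
          have : 0 ≤ Real.log m := Real.log_natCast_nonneg m
          gcongr
          exact (card_filter_le _ _).trans hcard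
      _ = _ := by field_simp
  have h4 := sum_filter_add_sum_filter_not S (· ≤ m) (fun q => Real.log q / (q:ℝ))
  rw [← h4] at h1
  linarith

open Finset in
lemma sum_log_main (f : ℕ → ℤ) (N M : ℕ) (S T : Finset ℕ) (hT : T ⊆ range N)
    (h0 : ∀ t ∈ T, f t ≠ 0) (hM : ∀ t ∈ T, (f t).natAbs ≤ M)
    (h4 : ∀ t ∈ T, ¬ (4:ℤ) ∣ f t) (h3 : ∀ t ∈ T, ¬ (3:ℤ) ∣ f t)
    (hS : ∀ q ∈ S, q.Prime ∧ 5 ≤ q)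
    (hTS : ∀ t ∈ T, ∀ q : ℕ, q.Prime → 5 ≤ q → (q:ℤ) ∣ f t → q ∈ S)
    (hc : ∀ q ∈ S, ∀ e, 1 ≤ e → ((range N).filter (fun t => ((q:ℤ)^e ∣ f t))).card ≤ 3 * (N / q ^ e + 1)) :
    ∑ t ∈ T, Real.log (f t).natAbs ≤ N * Real.log 2 + 
      ∑ q ∈ S, (3 * N * (Real.log q / (q - 1)) + 3 * Real.log M) := by
  have step1 : ∀ t ∈ T, Real.log (f t).natAbs ≤ Real.log 2 + 
      ∑ q ∈ S, ((f t).natAbs.factorization q : ℝ) * Real.log q := by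
    intro t ht
    set n := (f t).natAbs with hn
    have hn0 : n ≠ 0 := by simpa [hn] using h0 t ht
    have h1 : Real.log n = ∑ q ∈ n.primeFactors, (n.factorization q : ℝ) * Real.log q := by
      conv_lhs => rw [← Nat.prod_factorization_pow_eq_self hn0]
      rw [Finsupp.prod, Nat.cast_prod, Real.log_prod]
      · simp
      · intro q hq
        have := (Nat.prime_of_mem_primeFactors (by simpa using hq)).pos
        positivity
    have hsub : n.primeFactors ⊆ insert 2 S := by
      intro q hq
      have hp := Nat.prime_of_mem_primeFactors hq
      have hd := Nat.dvd_of_mem_primeFactors hq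
      have hd' : (q:ℤ) ∣ f t := Int.natCast_dvd.mpr hd
      by_cases h5 : 5 ≤ q
      · exact mem_insert_of_mem (hTS t ht q hp h5 hd')
      · have : q ≠ 3 := by rintro rfl; exact h3 t ht (by exact_mod_cast hd')
        have := hp.two_le
        have : q ≠ 4 := by rintro rfl; revert hp; decide
        have : q = 2 := by omega
        simp [this]
    rw [h1]
    refine (sum_le_sum_of_subset_of_nonneg hsub fun q _ _ => ?_).trans ?_
    · have := Real.log_natCast_nonneg q
      positivity
    · rw [sum_insert]
      · have h2 : n.factorization 2 ≤ 1 := by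
          by_contra h
          have : 2 ^ 2 ∣ n := (Nat.prime_two.pow_dvd_iff_le_factorization hn0).mpr (by omega)
          exact h4 t ht (by have := Int.natCast_dvd.mpr this; simpa using this)
        have : (n.factorization 2 : ℝ) ≤ 1 := by exact_mod_cast h2
        have hl : 0 ≤ Real.log 2 := Real.log_nonneg (by norm_num)
        push_cast
        nlinarith
      · intro h
        have := (hS 2 h).2
        omega
  have step2 : ∀ q ∈ S, ∑ t ∈ T, ((f t).natAbs.factorization q : ℝ) * Real.log q ≤ 
      3 * N * (Real.log q / (q - 1)) + 3 * Real.log M := by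
    intro q hq
    obtain ⟨hp, hq5⟩ := hS q hq
    have hq5' : (5:ℝ) ≤ q := by exact_mod_cast hq5
    have hlog : 0 ≤ Real.log q := Real.log_natCast_nonneg q
    set E := Nat.log q M with hE
    have hv : ∀ t ∈ T, (f t).natAbs.factorization q = ∑ e ∈ Ico 1 (E + 1), if (q:ℤ) ^ e ∣ f t then 1 else 0 := by
      intro t ht
      rw [Nat.factorization_eq_card_pow_dvd_of_lt hp (b := E + 1)
        (Nat.pos_of_ne_zero (by simpa using h0 t ht))
        ((hM t ht).trans_lt (Nat.lt_pow_succ_log_self hp.one_lt M)), card_filter]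
      refine sum_congr rfl fun e _ => ?_
      congr 1
      rw [← Int.natCast_dvd]; push_cast; rfl
    have hsum : ∑ t ∈ T, (f t).natAbs.factorization q ≤ ∑ e ∈ Ico 1 (E + 1), 3 * (N / q ^ e + 1) := by
      rw [sum_congr rfl hv, sum_comm]
      refine sum_le_sum fun e he => ?_
      rw [← card_filter]
      refine (card_le_card (filter_subset_filter _ hT)).trans (hc q hq e (mem_Ico.mp he).1)
    have hgeom : ∀ E : ℕ, ∑ e ∈ Ico 1 (E + 1), (1 / (q:ℝ)) ^ e ≤ 1 / (q - 1) := by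
      intro E
      have : ∑ e ∈ Ico 1 (E + 1), (1 / (q:ℝ)) ^ e = 1 / (q - 1) - (1 / (q:ℝ)) ^ E / (q - 1) := by
        induction E with
        | zero => simp
        | succ k ih => 
          rw [sum_Ico_succ_top (by omega), ih, pow_succ]
          have : (q:ℝ) - 1 ≠ 0 := by linarith
          have : (q:ℝ) ≠ 0 := by linarith
          field_simp
          ring
      rw [this]
      have : 0 ≤ (1 / (q:ℝ)) ^ E / (q - 1) := div_nonneg (by positivity) (by linarith)
      linarith
    have hsumR : ∑ t ∈ T, ((f t).natAbs.factorization q : ℝ) ≤ 3 * N * (1 / (q - 1)) + 3 * E := by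
      have h1 : ((∑ t ∈ T, (f t).natAbs.factorization q : ℕ) : ℝ) ≤ ((∑ e ∈ Ico 1 (E + 1), 3 * (N / q ^ e + 1) : ℕ) : ℝ) := by
        exact_mod_cast hsum
      push_cast at h1
      refine h1.trans ?_
      calc _ ≤ ∑ e ∈ Ico 1 (E + 1), (3 * N * (1 / (q:ℝ)) ^ e + 3) := by
            refine sum_le_sum fun e _ => ?_
            have : ((N / q ^ e : ℕ) : ℝ) ≤ N / ((q ^ e : ℕ) : ℝ) := Nat.cast_div_le
            have h2 : (N:ℝ) / ((q ^ e : ℕ) : ℝ) = N * (1 / (q:ℝ)) ^ e := by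
              push_cast; rw [one_div, inv_pow]; rfl
            rw [h2] at this
            linarith
        _ = 3 * N * ∑ e ∈ Ico 1 (E + 1), (1 / (q:ℝ)) ^ e + 3 * E := by
            rw [sum_add_distrib, mul_sum]; simp; ring
        _ ≤ _ := by
            have := hgeom E
            gcongr
    have hEM : (E:ℝ) * Real.log q ≤ Real.log M := by
      by_cases hM0 : M = 0
      · simp [hE, hM0]
      · rw [← Real.log_pow]
        apply Real.log_le_log
        · have := hp.pos; positivity
        · exact_mod_cast Nat.pow_log_le_self q hM0
    rw [← sum_mul]
    calc _ ≤ (3 * N * (1 / ((q:ℝ) - 1)) + 3 * E) * Real.log q := by gcongr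
      _ = 3 * N * (Real.log q / (q - 1)) + 3 * (E * Real.log q) := by ring
      _ ≤ _ := by linarith
  calc _ ≤ ∑ t ∈ T, (Real.log 2 + ∑ q ∈ S, ((f t).natAbs.factorization q : ℝ) * Real.log q) := sum_le_sum step1
    _ = T.card * Real.log 2 + ∑ q ∈ S, ∑ t ∈ T, ((f t).natAbs.factorization q : ℝ) * Real.log q := by
        rw [sum_add_distrib, sum_comm]; simp
    _ ≤ _ := by
        have hl : 0 ≤ Real.log 2 := Real.log_nonneg (by norm_num)
        have : (T.card : ℝ) ≤ N := by
          have := card_le_card hT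
          rw [card_range] at this
          exact_mod_cast this
        gcongr with q hq
        exact step2 q hq

open Polynomial in
lemma card_cubic_roots {R : Type*} [CommRing R] [IsDomain R] (c3 c2 c1 c0 : R) (h : c3 ≠ 0 ∨ c2 ≠ 0)
    (s : Finset R) (hs : ∀ x ∈ s, c3 * x ^ 3 + c2 * x ^ 2 + c1 * x + c0 = 0) : s.card ≤ 3 := by
  set P : R[X] := C c3 * X ^ 3 + C c2 * X ^ 2 + C c1 * X + C c0 with hP
  have hd : P.natDegree ≤ 3 := by rw [hP]; compute_degree
  have hP0 : P ≠ 0 := by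
    intro h0
    have e3 : P.coeff 3 = c3 := by rw [hP]; simp [coeff_X, coeff_C]
    have e2 : P.coeff 2 = c2 := by rw [hP]; simp [coeff_X, coeff_C]
    rw [h0] at e3 e2
    simp at e3 e2
    rcases h with h | h
    · exact h e3.symm
    · exact h e2.symm
  refine le_trans (card_le_degree_of_subset_roots (p := P) ?_) hd
  intro x hx
  rw [mem_roots hP0, IsRoot, hP]
  simpa using hs x hx

open Finset in
lemma card_congr_class (N m : ℕ) (hm : 0 < m) (s : Finset ℕ) (hs : s ⊆ range N)
    (h : ∀ t ∈ s, ∀ t' ∈ s, t ≡ t' [MOD m]) : s.card ≤ N / m + 1 := by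
  rw [← card_range (N / m + 1)]
  refine card_le_card_of_injOn (fun t => t / m) ?_ ?_
  · intro t ht
    have := mem_range.mp (hs ht)
    simp only [coe_range, Set.mem_Iio]
    have := Nat.div_le_div_right (c := m) this.le
    omega
  · intro t ht t' ht' hh
    have h1 := h t ht t' ht'
    rw [← Nat.div_add_mod t m, ← Nat.div_add_mod t' m, h1]
    simp only at hh
    rw [hh]

lemma form_ne_zero {p q : ℕ} (hp : p.Prime) (hq : q.Prime) (a b : ℤ)
    (hn : a ^ 2 - 3 * a * b + 9 * b ^ 2 = p) (ha : (q:ℤ) ∣ a) (hb : (q:ℤ) ∣ b) : False := by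
  obtain ⟨c, rfl⟩ := ha
  obtain ⟨d, rfl⟩ := hb
  have h1 : ((q ^ 2 : ℕ) : ℤ) ∣ (p : ℤ) := ⟨c ^ 2 - 3 * c * d + 9 * d ^ 2, by rw [← hn]; push_cast; ring⟩
  have h2 : q ^ 2 ∣ p := by exact_mod_cast h1
  have h3 := (Nat.dvd_prime hp).mp h2
  have := hq.two_le
  rcases h3 with h | h
  · nlinarith
  · rw [← h] at hp
    exact Nat.Prime.not_prime_pow (le_refl 2) hp

lemma deriv_ne_zero {p q : ℕ} (hp : p.Prime) [Fact q.Prime] (hq5 : 5 ≤ q) (hpq : q ≠ p) (a b x y : ℤ)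
    (hn : a ^ 2 - 3 * a * b + 9 * b ^ 2 = p) (hy : ¬ (q:ℤ) ∣ y) (h : (q:ℤ) ∣ cf a b x y)
    (h' : (q:ℤ) ∣ 3 * b * x ^ 2 - 2 * a * x * y + (a - 3 * b) * y ^ 2) : False := by
  have hqp : q.Prime := Fact.out
  have hyK : (y : ZMod q) ≠ 0 := by rwa [Ne, ZMod.intCast_zmod_eq_zero_iff_dvd]
  have hpK : (p : ZMod q) ≠ 0 := by
    rw [Ne, ZMod.natCast_eq_zero_iff]
    intro h
    exact hpq ((Nat.prime_dvd_prime_iff_eq hqp hp).mp h)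
  have e : ((cf a b x y : ℤ) : ZMod q) = 0 := by rwa [ZMod.intCast_zmod_eq_zero_iff_dvd]
  have e' : ((3 * b * x ^ 2 - 2 * a * x * y + (a - 3 * b) * y ^ 2 : ℤ) : ZMod q) = 0 := by
    rwa [ZMod.intCast_zmod_eq_zero_iff_dvd]
  have en : ((a ^ 2 - 3 * a * b + 9 * b ^ 2 : ℤ) : ZMod q) = ((p:ℤ) : ZMod q) := by rw [hn]
  rw [cf] at e
  push_cast at e e' en
  have h1 : (p : ZMod q) * y ^ 2 * (y - 2 * x) = 0 := by
    rw [← en]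
    linear_combination 9 * (b : ZMod q) * e - (3 * b * x - a * y) * e'
  have h2 : (y : ZMod q) = 2 * x := by
    have := (mul_eq_zero.mp h1).resolve_left (mul_ne_zero hpK (pow_ne_zero 2 hyK))
    linear_combination this
  have hx : (x : ZMod q) ≠ 0 := by
    intro hx; rw [hx] at h2; exact hyK (by rw [h2]; ring)
  have hsm : ∀ n : ℕ, 0 < n → n < 5 → (n : ZMod q) ≠ 0 := by
    intro n hn hn5 h
    rw [ZMod.natCast_eq_zero_iff] at h
    have := Nat.le_of_dvd hn h
    omega
  have h3' : (3 : ZMod q) ≠ 0 := by exact_mod_cast hsm 3 (by norm_num) (by norm_num)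
  have h2' : (2 : ZMod q) ≠ 0 := by exact_mod_cast hsm 2 (by norm_num) (by norm_num)
  have hb : (b : ZMod q) = 0 := by
    rw [h2] at e'
    have : (3:ZMod q) * 3 * b * x ^ 2 = 0 := by linear_combination -e'
    have h9 := (mul_eq_zero.mp this).resolve_right (pow_ne_zero 2 hx)
    exact (mul_eq_zero.mp h9).resolve_left (mul_ne_zero h3' h3')
  have ha : (a : ZMod q) = 0 := by
    rw [h2, hb] at e
    have : (2:ZMod q) * a * x ^ 3 = 0 := by linear_combination e
    have h9 := (mul_eq_zero.mp this).resolve_right (pow_ne_zero 3 hx)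
    exact (mul_eq_zero.mp h9).resolve_left h2'
  apply hpK
  rw [← en, ha, hb]; ring

open Finset in
lemma card_roots_pow {p q : ℕ} (hp : p.Prime) (hq : q.Prime) (hq5 : 5 ≤ q) (a b y : ℤ)
    (hn : a ^ 2 - 3 * a * b + 9 * b ^ 2 = p) (hy : ¬ (q:ℤ) ∣ y) (N e : ℕ) (he : 1 ≤ e)
    (hpe : q ≠ p ∨ e = 1) :
    ((range N).filter (fun t : ℕ => ((q:ℤ)^e ∣ cf a b (12 * t + 1) y))).card ≤ 3 * (N / q ^ e + 1) := by
  have : Fact q.Prime := ⟨hq⟩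
  have hyK : (y : ZMod q) ≠ 0 := by rwa [Ne, ZMod.intCast_zmod_eq_zero_iff_dvd]
  set s := (range N).filter (fun t : ℕ => ((q:ℤ)^e ∣ cf a b (12 * t + 1) y)) with hs
  have hdq : ∀ t ∈ s, (q:ℤ) ∣ cf a b (12 * t + 1) y := fun t ht =>
    (dvd_pow_self _ (by omega)).trans (mem_filter.mp ht).2
  have h1 : (s.image (fun t : ℕ => ((12 * t + 1 : ℤ) : ZMod q))).card ≤ 3 := by
    apply card_cubic_roots (b : ZMod q) (-a * y : ZMod q) ((a - 3 * b) * y ^ 2) (b * y ^ 3)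
    · by_contra! h
      have hb := h.1
      have ha : (a : ZMod q) = 0 := by
        have := h.2
        simpa [hyK] using this
      rw [ZMod.intCast_zmod_eq_zero_iff_dvd] at ha hb
      exact form_ne_zero hp hq a b hn ha hb
    · intro x hx
      obtain ⟨t, ht, rfl⟩ := mem_image.mp hx
      have := hdq t ht
      rw [← ZMod.intCast_zmod_eq_zero_iff_dvd, cf] at this
      push_cast at this ⊢
      linear_combination this
  have h2 : s.card ≤ (N / q ^ e + 1) * (s.image (fun t : ℕ => ((12 * t + 1 : ℤ) : ZMod q))).card := by
    apply card_le_mul_card_image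
    intro c _
    apply card_congr_class N (q ^ e) (pow_pos hq.pos e)
    · exact (filter_subset _ _).trans (filter_subset _ _)
    intro t ht t' ht'
    rw [mem_filter] at ht ht'
    have hcong : (q:ℤ) ∣ (12 * t + 1) - (12 * t' + 1) := by
      rw [← ZMod.intCast_zmod_eq_zero_iff_dvd, Int.cast_sub, ht.2, ht'.2, sub_self]
    have hcop : IsCoprime ((q:ℤ) ^ e) 12 := by
      apply IsCoprime.pow_left
      rw [Int.isCoprime_iff_gcd_eq_one]
      have : Nat.Coprime q 12 := by
        rw [Nat.Prime.coprime_iff_not_dvd hq]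
        intro h
        have : q ∣ 2 ^ 2 * 3 := by simpa using h
        rcases (Nat.Prime.dvd_mul hq).mp this with h | h
        · have := Nat.le_of_dvd (by norm_num) (hq.dvd_of_dvd_pow h); omega
        · have := Nat.le_of_dvd (by norm_num) h; omega
      exact_mod_cast this
    have hfin : (q:ℤ) ^ e ∣ 12 * ((t:ℤ) - t') := by
      rcases hpe with hpq | rfl
      · have hd : (q:ℤ) ^ e ∣ cf a b (12 * t + 1) y - cf a b (12 * t' + 1) y :=
          dvd_sub (mem_filter.mp ht.1).2 (mem_filter.mp ht'.1).2
        set x : ℤ := 12 * t + 1 with hx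
        set x' : ℤ := 12 * t' + 1 with hx'
        have hfac : cf a b x y - cf a b x' y = (x - x') * 
            (b * (x ^ 2 + x * x' + x' ^ 2) - a * y * (x + x') + (a - 3 * b) * y ^ 2) := by
          rw [cf, cf]; ring
        rw [hfac] at hd
        have hxx : x - x' = 12 * ((t:ℤ) - t') := by rw [hx, hx']; ring
        rw [← hxx]
        refine IsCoprime.dvd_of_dvd_mul_right ?_ hd
        apply IsCoprime.pow_left
        rw [Int.isCoprime_iff_gcd_eq_one]
        refine (Nat.Prime.coprime_iff_not_dvd hq).mpr ?_
        intro hdv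
        have hdv' : (q:ℤ) ∣ b * (x ^ 2 + x * x' + x' ^ 2) - a * y * (x + x') + (a - 3 * b) * y ^ 2 :=
          Int.natCast_dvd.mpr hdv
        refine deriv_ne_zero hp hq5 hpq a b x y hn hy (hdq t ht.1) ?_
        obtain ⟨k, hk⟩ := hcong
        obtain ⟨l, hl⟩ := hdv'
        have : x' = x - q * k := by linarith
        refine ⟨l + k * (3 * b * x - b * q * k - a * y), ?_⟩
        rw [this] at hl
        linear_combination hl
      · rw [pow_one]
        have : 12 * ((t:ℤ) - t') = (12 * t + 1) - (12 * t' + 1) := by ring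
        rwa [this]
    have h5 := hcop.dvd_of_dvd_mul_left hfin
    rw [Nat.ModEq.comm, Nat.modEq_iff_dvd]
    push_cast
    exact h5
  calc s.card ≤ _ := h2
    _ ≤ (N / q ^ e + 1) * 3 := by gcongr
    _ = _ := by ring

open Finset in
lemma card_small {p : ℕ} (hp : p.Prime) (a b y : ℤ)
    (hn : a ^ 2 - 3 * a * b + 9 * b ^ 2 = p) (hy : y ≠ 0) (N B : ℕ) :
    ((range N).filter (fun t : ℕ => (cf a b (12 * t + 1) y).natAbs ≤ B)).card ≤ 3 * (2 * B + 1) := by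
  have hc : (Icc (-(B:ℤ)) B).card = 2 * B + 1 := by simp; omega
  rw [← hc]
  apply card_le_mul_card_image_of_maps_to (f := fun t : ℕ => cf a b (12 * t + 1) y)
  · intro t ht
    have := (mem_filter.mp ht).2
    rw [mem_Icc]; omega
  · intro v _
    rw [← card_image_of_injective (f := fun t : ℕ => (12 * t + 1 : ℤ)) _ (by intro t t' h; simp at h; exact h)]
    apply card_cubic_roots b (-a * y) ((a - 3 * b) * y ^ 2) (b * y ^ 3 - v)
    · by_contra! h
      have hb := h.1
      have ha : a = 0 := by
        have := h.2
        simpa [hy] using this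
      rw [ha, hb] at hn
      have := hp.pos
      norm_num at hn
      omega
    · intro x hx
      obtain ⟨t, ht, rfl⟩ := mem_image.mp hx
      have := (mem_filter.mp ht).2
      rw [cf] at this
      linear_combination this

lemma exists_y {p : ℕ} (hp : p.Prime) (hp2 : p ≠ 2) (a b : ℤ) (ha : a % 3 = 2)
    (hn : a ^ 2 - 3 * a * b + 9 * b ^ 2 = p) :
    ∃ y : ℤ, (y = 8 ∨ y = -1) ∧ ∀ t : ℕ, ¬ (4:ℤ) ∣ cf a b (12 * t + 1) y ∧ ¬ (3:ℤ) ∣ cf a b (12 * t + 1) y := by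
  have h3 : ∀ y : ℤ, y % 3 = 2 → ∀ t : ℕ, ¬ (3:ℤ) ∣ cf a b (12 * t + 1) y := by
    intro y hy t h
    replace h := (ZMod.intCast_zmod_eq_zero_iff_dvd (cf a b (12 * t + 1) y) 3).mpr (by exact_mod_cast h)
    have ea : ((a:ℤ) : ZMod 3) = ((2:ℤ) : ZMod 3) := by
      rw [ZMod.intCast_eq_intCast_iff]; exact ha
    have ey : ((y:ℤ) : ZMod 3) = ((2:ℤ) : ZMod 3) := by
      rw [ZMod.intCast_eq_intCast_iff]; exact hy
    rw [cf] at h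
    push_cast at h ea ey
    rw [ea, ey] at h
    have e12 : (12 : ZMod 3) = 0 := rfl
    rw [e12] at h
    generalize (b : ZMod 3) = b' at h
    revert h
    revert b'
    simp only [zero_mul, zero_add]
    decide
  by_cases hb : (4:ℤ) ∣ b
  · refine ⟨-1, Or.inr rfl, fun t => ⟨?_, h3 _ (by norm_num) t⟩⟩
    intro h
    have hao : a % 2 = 1 := by
      by_contra h0
      exact form_ne_zero hp Nat.prime_two a b hn (by push_cast; omega) (by push_cast; omega)
    obtain ⟨c, rfl⟩ := hb
    obtain ⟨d, hd⟩ := h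
    rw [cf] at hd
    have : 2 * a = 4 * (d - c * (12 * t + 1) ^ 3 - 3 * a * t * (12 * t + 2) - 3 * a * t  + 3 * c * (12 * t + 1) + c - 0 - 3 * a * t + 3 * a * t) := by
      linear_combination hd
    omega
  · refine ⟨8, Or.inl rfl, fun t => ⟨?_, h3 _ (by norm_num) t⟩⟩
    rintro ⟨d, hd⟩
    apply hb
    rw [cf] at hd
    refine ⟨d - b * (432 * t ^ 3 + 108 * t ^ 2 + 9 * t) + 2 * a * (12 * t + 1) ^ 2 - (a - 3 * b) * (12 * t + 1) * 16 - 128 * b, ?_⟩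
    linear_combination hd

lemma cf_bound {p : ℕ} (a b y : ℤ) (hn : a ^ 2 - 3 * a * b + 9 * b ^ 2 = p) (hy : y = 8 ∨ y = -1)
    (N t : ℕ) (ht : t < N) :
    ((cf a b (12 * t + 1) y).natAbs : ℝ) ≤ 2000000 * Real.sqrt p * N ^ 3 := by
  have hnR : (a:ℝ) ^ 2 - 3 * a * b + 9 * b ^ 2 = p := by exact_mod_cast hn
  set r := Real.sqrt p with hr
  have hr0 : 0 ≤ r := Real.sqrt_nonneg _
  have hrr : r ^ 2 = p := Real.sq_sqrt (by positivity)
  have hb : |(b:ℝ)| ≤ r := by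
    apply abs_le_of_sq_le_sq _ hr0
    nlinarith [sq_nonneg (2 * (a:ℝ) - 3 * b), sq_nonneg (b:ℝ)]
  have ha : |(a:ℝ)| ≤ 2 * r := by
    apply abs_le_of_sq_le_sq _ (by positivity)
    nlinarith [sq_nonneg ((a:ℝ) - 6 * b), sq_nonneg (a:ℝ)]
  have hy8 : |(y:ℝ)| ≤ 8 := by rcases hy with rfl | rfl <;> norm_num
  have hN1 : (1:ℝ) ≤ N := by exact_mod_cast (by omega : 1 ≤ N)
  set X : ℝ := 12 * N with hX
  have hX1 : 1 ≤ X := by rw [hX]; linarith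
  have hx : |(12 * t + 1 : ℝ)| ≤ X := by
    rw [abs_of_nonneg (by positivity), hX]
    have : (t:ℝ) + 1 ≤ N := by exact_mod_cast ht
    linarith
  rw [Nat.cast_natAbs, cf]
  push_cast
  set x : ℝ := 12 * t + 1
  have t1 : |(b:ℝ) * x ^ 3| ≤ r * X ^ 3 := by
    rw [abs_mul, abs_pow]; gcongr
  have t2 : |(a:ℝ) * x ^ 2 * y| ≤ 2 * r * X ^ 2 * 8 := by
    rw [abs_mul, abs_mul, abs_pow]; gcongr
  have hab : |(a:ℝ) - 3 * b| ≤ 5 * r := by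
    rw [abs_le] at *; constructor <;> linarith
  have t3 : |((a:ℝ) - 3 * b) * x * y ^ 2| ≤ 5 * r * X * 8 ^ 2 := by
    rw [abs_mul, abs_mul, abs_pow]; gcongr
  have t4 : |(b:ℝ) * y ^ 3| ≤ r * 8 ^ 3 := by
    rw [abs_mul, abs_pow]; gcongr
  have e2 : X ^ 2 ≤ X ^ 3 := pow_le_pow_right₀ hX1 (by norm_num)
  have e1 : X ≤ X ^ 3 := by simpa using pow_le_pow_right₀ hX1 (show 1 ≤ 3 by norm_num)
  have e0 : 1 ≤ X ^ 3 := one_le_pow₀ hX1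
  have m2 := mul_le_mul_of_nonneg_left e2 hr0
  have m1 := mul_le_mul_of_nonneg_left e1 hr0
  have m0 := mul_le_mul_of_nonneg_left e0 hr0
  have eX : r * X ^ 3 = 1728 * (r * N ^ 3) := by rw [hX]; ring
  have hpos : 0 ≤ r * (N:ℝ) ^ 3 := by positivity
  rw [abs_le] at *
  constructor <;> nlinarith

open Finset in
lemma core_ineq (p : ℕ) (hp : p.Prime) (hp3 : p % 3 = 1) (N m : ℕ) (hN : 100 ≤ N) (hm : 3 ≤ m) (X : ℝ)
    (hX : 2000000 * Real.sqrt p * N ^ 3 < X)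
    (hcard : Nat.card {q : ℕ | q.Prime ∧ (q : ℝ) < X ∧
          ∃ x : ℤ, x ^ 3 ≡ (q : ℤ) [ZMOD (p : ℤ)]} ≤ m) :
    ((94 / 100 : ℝ) * N - 6 - 3 * N / p) * Real.log (N / 100) ≤
      N * Real.log 2 + N * (15 / 4) * (2 * Real.log m + Real.log 4) + 3 * m * Real.log X := by
  obtain ⟨a, b, hn, ha, hres⟩ := exists_form p hp hp3
  have hp5 : 5 ≤ p := by
    have := hp.two_le
    by_contra h
    have : p = 2 ∨ p = 3 ∨ p = 4 := by omega
    rcases this with rfl | rfl | rfl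
    · omega
    · omega
    · exact absurd hp (by norm_num)
  obtain ⟨y, hy, hy43⟩ := exists_y hp (by omega) a b ha hn
  set f : ℕ → ℤ := fun t => cf a b (12 * t + 1) y with hf
  set M : ℕ := ⌊2000000 * Real.sqrt p * N ^ 3⌋₊ with hM
  have hM0 : (0:ℝ) ≤ 2000000 * Real.sqrt p * N ^ 3 := by positivity
  have hMX : (M : ℝ) < X := lt_of_le_of_lt (Nat.floor_le hM0) hX
  have hfM : ∀ t, t < N → (f t).natAbs ≤ M := fun t ht =>
    Nat.le_floor (cf_bound a b y hn hy N t ht)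
  set B : ℕ := N / 100 with hB
  have hqy : ∀ q : ℕ, q.Prime → 5 ≤ q → ¬ (q:ℤ) ∣ y := by
    intro q hq hq5 h
    rcases hy with rfl | rfl
    · have h1 : q ∣ 2 ^ 3 := by exact_mod_cast h
      have := Nat.le_of_dvd (by norm_num) (hq.dvd_of_dvd_pow h1)
      omega
    · have h1 : q ∣ 1 := by
        have := Int.natAbs_dvd_natAbs.mpr h
        simpa using this
      have := Nat.le_of_dvd (by norm_num) h1
      omega
  set T1 := (range N).filter (fun t : ℕ => ((p:ℤ) ^ 1 ∣ f t)) with hT1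
  set T2 := (range N).filter (fun t : ℕ => (f t).natAbs ≤ B) with hT2
  set T := range N \ (T1 ∪ T2) with hT
  have hT1c : T1.card ≤ 3 * (N / p ^ 1 + 1) :=
    card_roots_pow hp hp hp5 a b y hn (hqy p hp hp5) N 1 le_rfl (Or.inr rfl)
  have hT2c : T2.card ≤ 3 * (2 * B + 1) :=
    card_small hp a b y hn (by rcases hy with rfl | rfl <;> norm_num) N B
  have hTc : N ≤ T.card + 3 * (N / p + 1) + 3 * (2 * B + 1) := by
    have h1 := card_union_le T1 T2
    have h2 := le_card_sdiff (T1 ∪ T2) (range N)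
    rw [card_range] at h2
    rw [pow_one] at hT1c
    rw [hT]
    omega
  have hTsub : T ⊆ range N := sdiff_subset
  have hTp : ∀ t ∈ T, ¬ (p:ℤ) ∣ f t := by
    intro t ht h
    have h1 := mem_sdiff.mp ht
    apply h1.2
    rw [mem_union]
    left
    rw [hT1, mem_filter]
    exact ⟨h1.1, by simpa using h⟩
  have hTB : ∀ t ∈ T, B < (f t).natAbs := by
    intro t ht
    by_contra h
    have h1 := mem_sdiff.mp ht
    apply h1.2
    rw [mem_union]
    right
    rw [hT2, mem_filter]
    exact ⟨h1.1, by omega⟩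
  classical
  set S := (range (M + 1)).filter (fun q : ℕ => q.Prime ∧ 5 ≤ q ∧ ∃ t ∈ T, (q:ℤ) ∣ f t) with hS
  have hSp : ∀ q ∈ S, q.Prime ∧ 5 ≤ q := fun q hq =>
    ⟨(mem_filter.mp hq).2.1, (mem_filter.mp hq).2.2.1⟩
  have hSne : ∀ q ∈ S, q ≠ p := by
    rintro q hq rfl
    obtain ⟨t, ht, h⟩ := (mem_filter.mp hq).2.2.2
    exact hTp t ht h
  have h0 : ∀ t ∈ T, f t ≠ 0 := by
    intro t ht h
    apply hTp t ht
    rw [h]; exact dvd_zero _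
  have hfin : {q : ℕ | q.Prime ∧ (q : ℝ) < X ∧
          ∃ x : ℤ, x ^ 3 ≡ (q : ℤ) [ZMOD (p : ℤ)]}.Finite := by
    apply (Set.finite_Iio (⌈X⌉₊)).subset
    rintro q ⟨_, hq, _⟩
    exact Nat.lt_ceil.mpr hq
  have hScard : S.card ≤ m := by
    refine le_trans ?_ hcard
    rw [← Set.ncard_coe_finset S]
    show (S : Set ℕ).ncard ≤ Set.ncard _
    refine Set.ncard_le_ncard ?_ hfin
    intro q hq
    have hq : q ∈ S := hq
    have h1 := mem_filter.mp hq
    obtain ⟨t, ht, h⟩ := h1.2.2.2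
    refine ⟨h1.2.1, ?_, hres q h1.2.1 h1.2.2.1 (hSne q hq) _ y (hqy q h1.2.1 h1.2.2.1) h⟩
    have : q ≤ M := by have := mem_range.mp h1.1; omega
    refine lt_of_le_of_lt ?_ hMX
    exact_mod_cast this
  have hmain := sum_log_main f N M S T hTsub h0 (fun t ht => hfM t (mem_range.mp (hTsub ht)))
    (fun t _ => (hy43 t).1) (fun t _ => (hy43 t).2) hSp
    (by
      intro t ht q hq hq5 h
      rw [hS, mem_filter, mem_range]
      refine ⟨?_, hq, hq5, t, ht, h⟩
      have h1 := hfM t (mem_range.mp (hTsub ht))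
      have h2 : q ∣ (f t).natAbs := Int.natCast_dvd.mp h
      have h3 := Nat.le_of_dvd (Int.natAbs_pos.mpr (h0 t ht)) h2
      omega)
    (fun q hq e he => card_roots_pow hp (hSp q hq).1 (hSp q hq).2 a b y hn (hqy q (hSp q hq).1 (hSp q hq).2) N e he (Or.inl (hSne q hq)))
  have hsl := sum_log_bound m hm S hSp hScard
  have hNr : (100:ℝ) ≤ N := by exact_mod_cast hN
  have hlogN : 0 ≤ Real.log ((N:ℝ) / 100) := Real.log_nonneg (by rw [le_div_iff₀ (by norm_num)]; linarith)
  have hBr : (N:ℝ) / 100 ≤ B + 1 := by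
    have : N ≤ 100 * (B + 1) := by omega
    have : (N:ℝ) ≤ 100 * (B + 1) := by exact_mod_cast this
    linarith
  have hBr2 : (B:ℝ) ≤ N / 100 := by
    have : 100 * B ≤ N := by omega
    have : 100 * (B:ℝ) ≤ N := by exact_mod_cast this
    linarith
  have hlow : (T.card : ℝ) * Real.log ((N:ℝ) / 100) ≤ ∑ t ∈ T, Real.log (f t).natAbs := by
    rw [← nsmul_eq_mul]
    apply card_nsmul_le_sum
    intro t ht
    apply Real.log_le_log (by linarith)
    refine hBr.trans ?_
    have := hTB t ht
    exact_mod_cast this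
  have hTr : (94 / 100 : ℝ) * N - 6 - 3 * N / p ≤ T.card := by
    have h1 : (N:ℝ) ≤ T.card + 3 * ((N / p : ℕ) + 1) + 3 * (2 * B + 1) := by exact_mod_cast hTc
    have h2 : ((N / p : ℕ) : ℝ) ≤ N / p := Nat.cast_div_le
    have h3 : 3 * (N:ℝ) / p = 3 * (N / p) := by ring
    rw [h3]
    linarith
  have hup : ∑ q ∈ S, (3 * N * (Real.log q / (q - 1)) + 3 * Real.log M) ≤
      N * (15 / 4) * (2 * Real.log m + Real.log 4) + 3 * m * Real.log X := by
    rw [sum_add_distrib, ← mul_sum, sum_const, nsmul_eq_mul]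
    have h1 : 0 ≤ Real.log M := Real.log_natCast_nonneg M
    have hM1 : 1 ≤ M := by
      apply Nat.le_floor
      have hs : (1:ℝ) ≤ Real.sqrt p := by
        rw [Real.one_le_sqrt]; exact_mod_cast hp.one_le
      have hn3 : (1:ℝ) ≤ (N:ℝ) ^ 3 := one_le_pow₀ (by linarith)
      push_cast
      nlinarith
    have h2 : Real.log M ≤ Real.log X := Real.log_le_log (by exact_mod_cast hM1) hMX.le
    have h3 : (S.card : ℝ) ≤ m := by exact_mod_cast hScard
    have h4 : (S.card : ℝ) * (3 * Real.log M) ≤ m * (3 * Real.log X) :=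
      mul_le_mul h3 (by linarith) (by linarith) (by positivity)
    have h5 : 3 * (N:ℝ) * ∑ q ∈ S, Real.log q / (q - 1) ≤ 3 * (N:ℝ) * (5 / 4 * (2 * Real.log m + Real.log 4)) :=
      mul_le_mul_of_nonneg_left hsl (by positivity)
    linarith
  have := mul_le_mul_of_nonneg_right hTr hlogN
  linarith

/-- Powers of `p` with positive exponent are eventually large. -/
lemma eventually_rpow_ge (c C : ℝ) (hc : 0 < c) : ∃ p₀ : ℕ, ∀ p : ℕ, p₀ < p → C ≤ (p:ℝ) ^ c := by
  have h := ((tendsto_rpow_atTop hc).comp tendsto_natCast_atTop_atTop).eventually_ge_atTop C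
  obtain ⟨p₀, h⟩ := Filter.eventually_atTop.mp h
  exact ⟨p₀, fun p hp => h p hp.le⟩

/-- For every ε > 0 there is a bound p₀(ε) such that for every prime p ≡ 1 (mod 3)
with p > p₀(ε), the number of primes q < p^(1/2+ε) that are cubic residues modulo p
exceeds p^(ε/30). -/
theorem many_small_prime_cubic_residues (ε : ℝ) (hε : 0 < ε) :
    ∃ p₀ : ℕ, ∀ p : ℕ, p.Prime → p % 3 = 1 → p₀ < p →
      (p : ℝ) ^ (ε / 30) <
        Nat.card {q : ℕ | q.Prime ∧ (q : ℝ) < (p : ℝ) ^ ((1 : ℝ) / 2 + ε) ∧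
          ∃ x : ℤ, x ^ 3 ≡ (q : ℤ) [ZMOD (p : ℤ)]} := by

  obtain ⟨p1, h1⟩ := eventually_rpow_ge (4 / 100 * ε) 2000001 (by positivity)
  obtain ⟨p2, h2⟩ := eventually_rpow_ge (43 / 150 * ε) (2 * (300 * (1 / 2 + ε) / ε)) (by positivity)
  obtain ⟨p3, h3⟩ := eventually_rpow_ge (ε / 30) 3 (by positivity)
  obtain ⟨p4, h4⟩ := eventually_rpow_ge (ε) (Real.exp 1000) (by positivity)
  refine ⟨p1 + p2 + p3 + p4 + 600, fun p hp hp3 hlt => ?_⟩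
  replace h1 := h1 p (by omega)
  replace h2 := h2 p (by omega)
  replace h3 := h3 p (by omega)
  replace h4 := h4 p (by omega)
  by_contra! hcon
  have hp0 : (0:ℝ) < p := by exact_mod_cast hp.pos
  have hp1 : (600:ℝ) ≤ p := by exact_mod_cast (by omega : 600 ≤ p)
  set L := Real.log p with hL
  have hL4 : 1000 ≤ ε * L := by
    have := Real.log_le_log (Real.exp_pos _) h4
    rwa [Real.log_exp, Real.log_rpow hp0] at this
  have hLpos : 0 < L := by
    by_contra! h
    nlinarith
  set R := (p:ℝ) ^ (32 / 100 * ε) with hR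
  set K := (p:ℝ) ^ (ε / 30) with hK
  have hR0 : 0 < R := Real.rpow_pos_of_pos hp0 _
  have hK0 : 0 < K := Real.rpow_pos_of_pos hp0 _
  have hRpow : R = ((p:ℝ) ^ (4 / 100 * ε)) ^ 8 := by
    rw [← Real.rpow_natCast, ← Real.rpow_mul hp0.le, hR]
    congr 1
    push_cast
    ring
  have hRbig : 2000001 ≤ R := by
    rw [hRpow]
    calc (2000001:ℝ) ≤ 2000001 ^ 8 := by norm_num
      _ ≤ _ := pow_le_pow_left₀ (by norm_num) h1 8
  set N : ℕ := ⌊R⌋₊ with hN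
  have hNle : (N:ℝ) ≤ R := Nat.floor_le hR0.le
  have hNge : R - 1 < N := Nat.sub_one_lt_floor R
  have hNhalf : R / 2 ≤ N := by linarith
  have hNr : (1200:ℝ) ≤ N := by linarith
  have hN0 : (0:ℝ) < N := by linarith
  set m : ℕ := ⌊K⌋₊ with hm
  have hmK : (m:ℝ) ≤ K := Nat.floor_le hK0.le
  have hm3 : 3 ≤ m := Nat.le_floor (by exact_mod_cast h3)
  have hX : 2000000 * Real.sqrt p * (N:ℝ) ^ 3 < (p:ℝ) ^ ((1:ℝ) / 2 + ε) := by
    have e : (p:ℝ) ^ ((1:ℝ) / 2 + ε) = Real.sqrt p * R ^ 3 * (p:ℝ) ^ (4 / 100 * ε) := by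
      rw [Real.sqrt_eq_rpow, hR, ← Real.rpow_natCast, ← Real.rpow_mul hp0.le, ← Real.rpow_add hp0,
        ← Real.rpow_add hp0]
      congr 1
      push_cast
      ring
    rw [e]
    have hs : 0 < Real.sqrt p := Real.sqrt_pos.mpr hp0
    have hN3 : (N:ℝ) ^ 3 ≤ R ^ 3 := pow_le_pow_left₀ hN0.le hNle 3
    have hR3 : 0 < Real.sqrt p * R ^ 3 := by positivity
    calc 2000000 * Real.sqrt p * (N:ℝ) ^ 3 ≤ 2000000 * Real.sqrt p * R ^ 3 :=
          mul_le_mul_of_nonneg_left hN3 (by positivity)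
      _ = (Real.sqrt p * R ^ 3) * 2000000 := by ring
      _ < _ := by
        apply mul_lt_mul_of_pos_left _ hR3
        linarith
  have hcore := core_ineq p hp hp3 N m (by exact_mod_cast (by linarith : (100:ℝ) ≤ N)) hm3 _ hX
    (Nat.le_floor hcon)
  rw [Real.log_rpow hp0, ← hL] at hcore
  have hlogm : Real.log m ≤ ε / 30 * L := by
    rw [hL, ← Real.log_rpow hp0]
    exact Real.log_le_log (by exact_mod_cast (by omega : 0 < m)) hmK
  have hlogN : 32 / 100 * ε * L - Real.log 200 ≤ Real.log ((N:ℝ) / 100) := by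
    rw [hL, ← Real.log_rpow hp0, ← Real.log_div hR0.ne' (by norm_num)]
    apply Real.log_le_log (by positivity)
    linarith
  have l2 : Real.log 2 ≤ 1 := by
    have := Real.log_le_sub_one_of_pos (by norm_num : (0:ℝ) < 2); linarith
  have l4 : Real.log 4 ≤ 2 := by
    rw [show (4:ℝ) = 2 ^ 2 by norm_num, Real.log_pow]; push_cast; linarith
  have l200 : Real.log 200 ≤ 8 := by
    have : Real.log 200 ≤ Real.log (2 ^ 8) := Real.log_le_log (by norm_num) (by norm_num)
    rw [Real.log_pow] at this; push_cast at this; linarith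
  -- the last term is negligible
  have hlast : 3 * (m:ℝ) * ((1 / 2 + ε) * L) ≤ 1 / 100 * (ε * L) * N := by
    have e : R = K * (p:ℝ) ^ (43 / 150 * ε) := by
      rw [hR, hK, ← Real.rpow_add hp0]
      congr 1
      ring
    have h5 : K * (2 * (300 * (1 / 2 + ε) / ε)) ≤ R := by
      rw [e]; exact mul_le_mul_of_nonneg_left h2 hK0.le
    have h6 : K * (300 * (1 / 2 + ε) / ε) ≤ N := by linarith
    have h7 : K * (300 * (1 / 2 + ε)) ≤ N * ε := by
      have := mul_le_mul_of_nonneg_right h6 hε.le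
      calc K * (300 * (1 / 2 + ε)) = K * (300 * (1 / 2 + ε) / ε) * ε := by field_simp
        _ ≤ _ := this
    have h8 : (m:ℝ) * (300 * (1 / 2 + ε)) ≤ N * ε :=
      le_trans (mul_le_mul_of_nonneg_right hmK (by positivity)) h7
    have h9 := mul_le_mul_of_nonneg_right h8 hLpos.le
    linarith
  have hcoef : (93 / 100 : ℝ) * N ≤ (94 / 100 : ℝ) * N - 6 - 3 * N / p := by
    have : 3 * (N:ℝ) / p ≤ 1 / 200 * N := by
      rw [div_le_iff₀ hp0]
      nlinarith
    linarith
  have hlow : (93 / 100 : ℝ) * N * (32 / 100 * (ε * L) - 8) ≤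
      ((94 / 100 : ℝ) * N - 6 - 3 * N / p) * Real.log (N / 100) := by
    apply mul_le_mul hcoef (by linarith) (by linarith)
    have : 0 ≤ (93 / 100 : ℝ) * N := by positivity
    linarith
  have hup : (N:ℝ) * Real.log 2 + N * (15 / 4) * (2 * Real.log m + Real.log 4) ≤
      N * (1 + (15 / 4) * (ε * L / 15 + 2)) := by
    rw [mul_assoc, ← mul_add]
    apply mul_le_mul_of_nonneg_left _ hN0.le
    linarith
  have hfin : (N:ℝ) * ((93 / 100 : ℝ) * (32 / 100 * (ε * L) - 8)) ≤
      N * (1 + (15 / 4) * (ε * L / 15 + 2) + 1 / 100 * (ε * L)) := by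
    linarith
  have := le_of_mul_le_mul_left hfin hN0
  linarith
end

section
/- For every ε > 0 there exists a bound p₀(ε) such that for every prime p ≡ 1 (mod 4) with p > p₀(ε), the number of primes q < p^{1/2+ε} for which q* is a biquadratic residue modulo p exceeds p^{ε/50}. -/
lemma bq_kernel {p : ℕ} [Fact p.Prime] {K : Type*} [Field K] (χ : MulChar (ZMod p) K)
    (h2 : χ ^ 2 ≠ 1) (h4 : χ ^ 4 = 1) (u : ZMod p) (hu : χ u = 1) : ∃ y : ZMod p, y ^ 4 = u := by
  have hu0 : u ≠ 0 := by
    rintro rfl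
    rw [MulChar.map_zero] at hu
    exact zero_ne_one hu
  obtain ⟨γ, hγ⟩ := IsCyclic.exists_generator (α := (ZMod p)ˣ)
  obtain ⟨m, hm⟩ := (Submonoid.mem_powers_iff _ _).1 (mem_powers_iff_mem_zpowers.2 (hγ (Units.mk0 u hu0)))
  have hm' : u = (γ : ZMod p) ^ m := by
    have := congrArg Units.val hm
    simpa using this.symm
  have hc4 : χ γ ^ 4 = 1 := by
    rw [← MulChar.pow_apply_coe, h4, MulChar.one_apply_coe]
  have hc2 : χ γ ^ 2 ≠ 1 := by
    intro hc
    apply h2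
    ext v
    obtain ⟨k, hk⟩ := (Submonoid.mem_powers_iff _ _).1 (mem_powers_iff_mem_zpowers.2 (hγ v))
    rw [MulChar.pow_apply_coe, MulChar.one_apply_coe, ← hk, Units.val_pow_eq_pow_val, map_pow,
      ← pow_mul, mul_comm, pow_mul, hc, one_pow]
  have ho : orderOf (χ γ) = 2 ^ 2 := orderOf_eq_prime_pow (p := 2) (n := 1) (by simpa using hc2) (by simpa using hc4)
  have hd : 4 ∣ m := by
    have : orderOf (χ γ) ∣ m := by
      apply orderOf_dvd_of_pow_eq_one
      rw [← map_pow, ← hm', hu]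
    rw [ho] at this
    simpa using this
  obtain ⟨k, rfl⟩ := hd
  exact ⟨(γ : ZMod p) ^ k, by rw [hm', ← pow_mul, mul_comm]⟩

lemma bq_core {p q : ℕ} [Fact p.Prime] [Fact q.Prime] (hq2 : q ≠ 2) (hqp : q ≠ p)
    {K : Type*} [Field K] [CharP K q] (χ : MulChar (ZMod p) K)
    (h2 : χ ^ 2 ≠ 1) (h4 : χ ^ 4 = 1) (ψ : AddChar (ZMod p) K) (hψ : ψ.IsPrimitive)
    (i : K) (hi : i ^ 2 = -1) (a b x : ℤ) (hJ : jacobiSum χ χ = a + b * i)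
    (hab : a ^ 2 + b ^ 2 = p) (hx : (q : ℤ) ∣ a * (4 * x ^ 3 - 4 * x) - b * (x ^ 4 - 6 * x ^ 2 + 1)) :
    χ ((((-1) ^ ((q - 1) / 2) * (q : ℤ) : ℤ)) : ZMod p) = 1 := by
  have hqP : q.Prime := Fact.out
  have hpP : p.Prime := Fact.out
  have hp0 : (p : K) ≠ 0 := by
    intro h
    rw [CharP.cast_eq_zero_iff K q] at h
    exact hqp ((Nat.prime_dvd_prime_iff_eq hqP hpP).1 h)
  have h20 : (2 : K) ≠ 0 := by
    intro h
    have : ((2 : ℕ) : K) = 0 := by exact_mod_cast h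
    rw [CharP.cast_eq_zero_iff K q] at this
    exact hq2 ((Nat.prime_dvd_prime_iff_eq hqP Nat.prime_two).1 this)
  have hF : (a : K) * (4 * x ^ 3 - 4 * x) - b * (x ^ 4 - 6 * x ^ 2 + 1) = 0 := by
    have := (CharP.intCast_eq_zero_iff K q _).2 hx
    push_cast at this
    exact this
  have habK : (a : K) ^ 2 + b ^ 2 = p := by exact_mod_cast congrArg (Int.cast : ℤ → K) hab
  have hi0 : i ≠ 0 := by
    rintro rfl
    simp at hi
  set J : K := a + b * i with hJd
  set J' : K := a - b * i with hJ'd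
  set z : K := x + i with hzd
  set z' : K := x - i with hz'd
  have hJJ : J * J' = p := by
    rw [← habK, hJd, hJ'd]; linear_combination (-(b : K) ^ 2) * hi
  have hJ0 : J ≠ 0 := fun h => hp0 (by rw [← hJJ, h, zero_mul])
  have hJ'0 : J' ≠ 0 := fun h => hp0 (by rw [← hJJ, h, mul_zero])
  have i3 : i ^ 3 = -i := by linear_combination i * hi
  have i4 : i ^ 4 = 1 := by linear_combination (i ^ 2 - 1) * hi
  have i5 : i ^ 5 = i := by linear_combination i * i4
  have hzz : J' * z ^ 4 = J * z' ^ 4 := by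
    rw [hJd, hJ'd, hzd, hz'd]
    ring_nf
    simp only [hi, i3, i4, i5]
    linear_combination (2 * i) * hF
  have hz0 : z ≠ 0 := by
    intro h
    rw [h] at hzz
    have h' : z' = 0 := by
      have : J * z' ^ 4 = 0 := by rw [← hzz]; ring
      simpa [hJ0] using this
    have : 2 * i = 0 := by linear_combination h - h'
    simp [h20, hi0] at this
  have hz'0 : z' ≠ 0 := by
    intro h
    rw [h] at hzz
    have h' : z = 0 := by
      have : J' * z ^ 4 = 0 := by rw [hzz]; ring
      simpa [hJ'0] using this
    exact hz0 h'
  set w : K := z' / z with hwd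
  have hw0 : w ≠ 0 := div_ne_zero hz'0 hz0
  have hJw : J' = J * w ^ 4 := by
    rw [hwd]; field_simp; exact hzz
  set g := gaussSum χ ψ with hg
  have hχ1 : χ ≠ 1 := fun h => h2 (by rw [h, one_pow])
  have hg0 : g ≠ 0 := gaussSum_ne_zero_of_nontrivial (by rw [ZMod.card]; exact hp0) hχ1 hψ
  have hm1 : χ (-1) ^ 2 = 1 := by
    rw [← map_pow]; simp
  have hg4 : g ^ 4 = (J * w) ^ 4 := by
    have h1 := jacobiSum_mul_nontrivial (χ := χ) (φ := χ) (by rwa [← pow_two]) ψ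
    rw [hJ, ← pow_two, ← hg] at h1
    have h3 : gaussSum (χ ^ 2) ψ ^ 2 = p := by
      have := gaussSum_mul_gaussSum_eq_card h2 hψ
      have hinv : (χ ^ 2)⁻¹ = χ ^ 2 := by
        rw [inv_eq_iff_mul_eq_one, ← pow_add, h4]
      have h5 := mul_gaussSum_inv_eq_gaussSum (χ ^ 2) ψ
      rw [MulChar.pow_apply' _ (by norm_num), hm1, one_mul] at h5
      rw [hinv, h5, ZMod.card] at this
      rw [pow_two, this]
    calc g ^ 4 = (g * g) ^ 2 := by ring
      _ = p * J ^ 2 := by rw [← h1, mul_pow, h3]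
      _ = (J * J') * J ^ 2 := by rw [hJJ]
      _ = _ := by rw [hJw]; ring
  have hfi : ∀ n : ℤ, frobenius K q (n : K) = n := fun n => map_intCast _ n
  have hqu : IsUnit ((q : ℕ) : ZMod p) := by
    rw [ZMod.isUnit_iff_coprime]
    exact (Nat.coprime_primes hqP hpP).2 hqp
  obtain ⟨Q, hQ⟩ := hqu
  have hfr := gaussSum_frob q χ ψ
  rw [AddChar.pow_mulShift, ← hg, ← hQ] at hfr
  have hodd := hqP.eq_two_or_odd.resolve_left hq2
  rcases (by omega : q % 4 = 1 ∨ q % 4 = 3) with hq4 | hq4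
  · obtain ⟨k, hk⟩ : ∃ k, q = 4 * k + 1 := ⟨q / 4, by omega⟩
    have hs : (-1 : ℤ) ^ ((q - 1) / 2) = 1 := by
      apply Even.neg_one_pow
      exact ⟨k, by omega⟩
    rw [hs, one_mul]
    have hχq : χ ^ q = χ := by rw [hk, pow_succ, pow_mul, h4, one_pow, one_mul]
    rw [hχq] at hfr
    have h5 := gaussSum_mulShift χ ψ Q
    rw [← hfr, ← hg, hQ] at h5
    have hfri : frobenius K q i = i := by
      rw [frobenius_def, hk, pow_succ, pow_mul, i4, one_pow, one_mul]
    have hfJw : (J * w) ^ q = J * w := by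
      rw [← frobenius_def, hwd, hJd, hzd, hz'd]
      simp only [map_mul, map_div₀, map_add, map_sub, hfi, hfri]
    have h6 : g ^ q = g := by
      have e1 : g ^ (4 * k) = (J * w) ^ (4 * k) := by rw [pow_mul, hg4, ← pow_mul]
      have e2 : (J * w) ^ (4 * k) = 1 := by
        have : (J * w) ^ (4 * k) * (J * w) = 1 * (J * w) := by
          rw [← pow_succ, ← hk, hfJw, one_mul]
        exact mul_right_cancel₀ (mul_ne_zero hJ0 hw0) this
      rw [hk, pow_succ, e1, e2, one_mul]
    rw [h6] at h5
    have : χ ((q : ℕ) : ZMod p) = 1 := mul_right_cancel₀ hg0 (by rw [h5, one_mul])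
    simpa using this
  · obtain ⟨k, hk⟩ : ∃ k, q = 4 * k + 3 := ⟨q / 4, by omega⟩
    have hs : (-1 : ℤ) ^ ((q - 1) / 2) = -1 := by
      apply Odd.neg_one_pow
      exact ⟨k, by omega⟩
    rw [hs]
    have hχq : χ ^ q = χ⁻¹ := by
      rw [hk, pow_add, pow_mul, h4, one_pow, one_mul, eq_inv_iff_mul_eq_one, ← pow_succ, h4]
    rw [hχq] at hfr
    have h5 := gaussSum_mulShift χ⁻¹ ψ Q
    rw [← hfr, hQ] at h5
    have hfri : frobenius K q i = -i := by
      rw [frobenius_def, hk, pow_add, pow_mul, i4, one_pow, one_mul, i3]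
    have hfJw : (J * w) ^ (q + 1) = p := by
      rw [pow_succ, ← frobenius_def]
      have : frobenius K q (J * w) = J' * w⁻¹ := by
        rw [hwd, hJd, hJ'd, hzd, hz'd, inv_div]
        simp only [map_mul, map_div₀, map_add, map_sub, hfi, hfri]
        ring
      rw [this, ← hJJ]
      field_simp
    have h6 : g ^ (q + 1) = p := by
      rw [← hfJw, show q + 1 = 4 * (k + 1) by omega, pow_mul, hg4, ← pow_mul]
    have h7 := gaussSum_mul_gaussSum_eq_card hχ1 hψ
    have h8 := mul_gaussSum_inv_eq_gaussSum χ⁻¹ ψ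
    rw [← h5] at h8
    rw [← hg, ZMod.card] at h7
    have hmm : χ⁻¹ (-1) = χ (-1) := by
      rw [MulChar.inv_apply', inv_neg_one]
    rw [hmm] at h8
    have h9 : χ (-1) * (p : K) = χ⁻¹ (q : ZMod p) * p := by
      rw [← h7]
      calc χ (-1) * (g * gaussSum χ⁻¹ ψ⁻¹) = g * (χ (-1) * gaussSum χ⁻¹ ψ⁻¹) := by ring
        _ = χ⁻¹ (q : ZMod p) * g ^ (q + 1) := by rw [h8]; ring
        _ = _ := by rw [h6, h7]
    have h10 := mul_right_cancel₀ hp0 h9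
    have h11 : χ (q : ZMod p) * χ⁻¹ (q : ZMod p) = 1 := by
      rw [← hQ, ← MulChar.mul_apply, mul_inv_cancel, MulChar.one_apply_coe]
    have : χ (-1) * χ (q : ZMod p) = 1 := by rw [h10, mul_comm, h11]
    rw [← map_mul] at this
    simpa using this

lemma bq_recip (p : ℕ) (hp : p.Prime) (hp4 : p % 4 = 1) : ∃ a b : ℤ, a ^ 2 + b ^ 2 = p ∧
    ∀ q : ℕ, q.Prime → q ≠ 2 → q ≠ p → ∀ x : ℤ,
      (q : ℤ) ∣ a * (4 * x ^ 3 - 4 * x) - b * (x ^ 4 - 6 * x ^ 2 + 1) →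
      ∃ y : ℤ, y ^ 4 ≡ (-1) ^ ((q - 1) / 2) * (q : ℤ) [ZMOD (p : ℤ)] := by
  have : Fact p.Prime := ⟨hp⟩
  let I : GaussianInt := ⟨0, 1⟩
  have hI2 : I ^ 2 = -1 := by rw [pow_two]; ext <;> simp [I]
  have hI : IsPrimitiveRoot I 4 := by
    apply IsPrimitiveRoot.iff_orderOf.2
    refine orderOf_eq_prime_pow (p := 2) (n := 1) ?_ ?_
    · rw [pow_one, hI2]; intro h; have := congrArg Zsqrtd.re h; simp at this
    · rw [show 2 ^ (1 + 1) = 2 * 2 by norm_num, pow_mul, hI2]; norm_num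
  obtain ⟨χ, hχ⟩ := MulChar.exists_mulChar_orderOf (ZMod p) (n := 4) (by rw [ZMod.card]; omega) hI
  have h4 : χ ^ 4 = 1 := by rw [← hχ, pow_orderOf_eq_one]
  have h2 : χ ^ 2 ≠ 1 := by
    intro h
    have := orderOf_dvd_of_pow_eq_one h
    rw [hχ] at this
    omega
  have h1 : χ ≠ 1 := fun h => h2 (by rw [h, one_pow])
  set J := jacobiSum χ χ with hJ
  have hnorm : J.re ^ 2 + J.im ^ 2 = p := by
    have hinj : Function.Injective GaussianInt.toComplex := by
      intro x y h
      exact GaussianInt.toComplex_inj.1 h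
    set χC := χ.ringHomComp GaussianInt.toComplex with hχC
    have hC1 : χC ≠ 1 := (MulChar.ringHomComp_ne_one_iff hinj).2 h1
    have hC2 : χC * χC ≠ 1 := by
      rw [hχC, ← MulChar.ringHomComp_mul, ← pow_two]
      exact (MulChar.ringHomComp_ne_one_iff hinj).2 h2
    have hm := jacobiSum_mul_jacobiSum_inv (F := ZMod p) (F' := ℂ) (by
      rw [ringChar.eq ℂ 0, ZMod.ringChar_zmod_n]; exact hp.ne_zero.symm) hC1 hC1 hC2
    have hst : jacobiSum χC⁻¹ χC⁻¹ = (starRingEnd ℂ) (jacobiSum χC χC) := by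
      rw [← jacobiSum_ringHomComp]
      have : χC.ringHomComp (starRingEnd ℂ) = χC⁻¹ := by
        ext u
        rw [MulChar.ringHomComp_apply]
        exact MulChar.star_apply' χC u
      rw [this]
    rw [hst, jacobiSum_ringHomComp, ← hJ, Complex.mul_conj, ZMod.card] at hm
    have hm' : Complex.normSq (GaussianInt.toComplex J) = (p : ℝ) := by exact_mod_cast hm
    rw [Complex.normSq_apply] at hm'
    rw [← GaussianInt.intCast_re, ← GaussianInt.intCast_im] at hm'
    have : J.re * J.re + J.im * J.im = p := by exact_mod_cast hm'
    rw [← this]; ring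
  refine ⟨J.re, J.im, hnorm, ?_⟩
  · intro q hq hq2 hqp x hx
    have : Fact q.Prime := ⟨hq⟩
    let K := AlgebraicClosure (ZMod q)
    have : CharP K q := charP_of_injective_algebraMap (algebraMap (ZMod q) K).injective q
    have hp0 : (p : K) ≠ 0 := by
      intro h
      rw [CharP.cast_eq_zero_iff K q] at h
      exact hqp ((Nat.prime_dvd_prime_iff_eq hq hp).1 h)
    have : NeZero (p : K) := ⟨hp0⟩
    obtain ⟨ζ, hζ⟩ := HasEnoughRootsOfUnity.exists_primitiveRoot K p
    obtain ⟨i, hi⟩ := IsAlgClosed.exists_pow_nat_eq (-1 : K) (n := 2) (by norm_num)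
    let f : GaussianInt →+* K := Zsqrtd.lift ⟨i, by rw [← pow_two, hi]; simp⟩
    have hf : ∀ z : GaussianInt, f z = z.re + z.im * i := fun z => rfl
    have hK4 : χ.ringHomComp f ^ 4 = 1 := by
      rw [MulChar.ringHomComp_pow, h4, MulChar.ringHomComp_one]
    have hK2 : χ.ringHomComp f ^ 2 ≠ 1 := by
      intro h
      apply h2
      ext1 u
      have h4u : (χ ^ 2) u * (χ ^ 2) u = 1 := by
        rw [← MulChar.mul_apply, ← pow_add, h4, MulChar.one_apply_coe]
      rw [MulChar.one_apply_coe]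
      rcases mul_self_eq_one_iff.1 h4u with h5 | h5
      · exact h5
      · exfalso
        have := congrArg (fun η : MulChar (ZMod p) K => η u) h
        rw [MulChar.ringHomComp_pow] at this
        simp only [MulChar.ringHomComp_apply, h5, MulChar.one_apply_coe, map_neg, map_one] at this
        have h20 : ((2 : ℕ) : K) = 0 := by push_cast; linear_combination -this
        rw [CharP.cast_eq_zero_iff K q] at h20
        exact hq2 ((Nat.prime_dvd_prime_iff_eq hq Nat.prime_two).1 h20)
    have key := bq_core (p := p) (q := q) hq2 hqp (χ.ringHomComp f) hK2 hK4 _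
      (AddChar.zmodChar_primitive_of_primitive_root p hζ) i hi J.re J.im x
      (by rw [jacobiSum_ringHomComp, ← hJ, hf]) hnorm hx
    obtain ⟨y, hy⟩ := bq_kernel _ hK2 hK4 _ key
    obtain ⟨y, rfl⟩ := ZMod.intCast_surjective y
    refine ⟨y, ?_⟩
    rw [← ZMod.intCast_eq_intCast_iff]
    rw [← hy]; push_cast; rfl

/-- The quartic polynomial `Im ((a - b i) (x + i)^4)`. -/
def bqF (a b x : ℤ) : ℤ := a * (4 * x ^ 3 - 4 * x) - b * (x ^ 4 - 6 * x ^ 2 + 1)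

open Polynomial in
lemma bq_roots {R : Type*} [CommRing R] [IsDomain R] (α β c : R) (h : β ≠ 0 ∨ 4 * α ≠ 0)
    (s : Finset R) (hs : ∀ x ∈ s, α * (4 * x ^ 3 - 4 * x) - β * (x ^ 4 - 6 * x ^ 2 + 1) = c) :
    s.card ≤ 4 := by
  let P : R[X] := C (-β) * X ^ 4 + C (4 * α) * X ^ 3 + C (6 * β) * X ^ 2 + C (-(4 * α)) * X + C (-β - c)
  have hP0 : P ≠ 0 := by
    intro h0
    have h4 : P.coeff 4 = -β := by
      simp only [P, coeff_add, coeff_C_mul, coeff_X_pow, coeff_X, coeff_C]; norm_num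
    have h3 : P.coeff 3 = 4 * α := by simp only [P, coeff_add, coeff_C_mul, coeff_X_pow, coeff_X, coeff_C]; norm_num
    rw [h0, coeff_zero] at h4 h3
    rcases h with h | h
    · exact h (by simpa using h4.symm)
    · exact h h3.symm
  have hd : P.natDegree ≤ 4 := by
    simp only [P]; compute_degree
  refine (Polynomial.card_le_degree_of_subset_roots (p := P) ?_).trans hd
  intro x hx
  have hx' : x ∈ s := hx
  rw [Polynomial.mem_roots hP0, IsRoot.def]
  simp only [P, eval_add, eval_mul, eval_C, eval_pow, eval_X]
  linear_combination hs x hx'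

lemma bq_lift (a b x y m : ℤ) (hab : IsCoprime a b) (hx : m ∣ bqF a b x) (hy : m ∣ bqF a b y) :
    m ∣ 4 * (x * y + 1) * ((x * y + 1) ^ 2 - (x - y) ^ 2) * (x - y) := by
  obtain ⟨s, t, hst⟩ := hab
  obtain ⟨k, hk⟩ := hx
  obtain ⟨l, hl⟩ := hy
  unfold bqF at hk hl
  -- a resultant combination of the two values
  have e : ((4 * x ^ 3 - 4 * x) * (y ^ 4 - 6 * y ^ 2 + 1) - (4 * y ^ 3 - 4 * y) * (x ^ 4 - 6 * x ^ 2 + 1))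
      = m * (s * (k * (y ^ 4 - 6 * y ^ 2 + 1) - l * (x ^ 4 - 6 * x ^ 2 + 1))
        + t * (k * (4 * y ^ 3 - 4 * y) - l * (4 * x ^ 3 - 4 * x))) := by
    linear_combination (-((4 * x ^ 3 - 4 * x) * (y ^ 4 - 6 * y ^ 2 + 1)
      - (4 * y ^ 3 - 4 * y) * (x ^ 4 - 6 * x ^ 2 + 1))) * hst
      + (s * (y ^ 4 - 6 * y ^ 2 + 1) + t * (4 * y ^ 3 - 4 * y)) * hk
      - (s * (x ^ 4 - 6 * x ^ 2 + 1) + t * (4 * x ^ 3 - 4 * x)) * hl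
  have e2 : 4 * (x * y + 1) * ((x * y + 1) ^ 2 - (x - y) ^ 2) * (x - y) =
    -((4 * x ^ 3 - 4 * x) * (y ^ 4 - 6 * y ^ 2 + 1) - (4 * y ^ 3 - 4 * y) * (x ^ 4 - 6 * x ^ 2 + 1)) := by
    ring
  rw [e2, e, dvd_neg]
  exact dvd_mul_right _ _

lemma bq_not_dvd {p q : ℕ} (hp : p.Prime) (hq : q.Prime) (hq2 : q ≠ 2) (hqp : q ≠ p) (a b x : ℤ)
    (hab : a ^ 2 + b ^ 2 = p) (hx : (q : ℤ) ∣ bqF a b x) : ¬ (q : ℤ) ∣ x ^ 2 + 1 := by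
  intro h
  have hqZ : Prime (q : ℤ) := Nat.prime_iff_prime_int.1 hq
  have h1 : (q : ℤ) ∣ 8 * x * (b * x - a) := by
    have : 8 * x * (b * x - a) = bqF a b x + (x ^ 2 + 1) * (b * (x ^ 2 + 1) - 4 * a * x) := by
      unfold bqF; ring
    rw [this]
    exact dvd_add hx (Dvd.dvd.mul_right h _)
  rcases hqZ.dvd_or_dvd h1 with h1 | h1
  · rcases hqZ.dvd_or_dvd h1 with h1 | h1
    · have h2 : (q : ℤ) ∣ 2 := by
        have : (q : ℤ) ∣ 2 ^ 3 := by norm_num; exact h1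
        exact hqZ.dvd_of_dvd_pow this
      have : q ∣ 2 := by exact_mod_cast h2
      exact hq2 ((Nat.prime_dvd_prime_iff_eq hq Nat.prime_two).1 this)
    · have : (q : ℤ) ∣ 1 := by
        have h3 := dvd_sub h (Dvd.dvd.mul_right h1 x)
        have : x ^ 2 + 1 - x * x = 1 := by ring
        rwa [this] at h3
      exact hqZ.not_dvd_one this
  · have : (q : ℤ) ∣ p := by
      have e : (p : ℤ) = b ^ 2 * (x ^ 2 + 1) - (b * x - a) * (b * x + a) := by rw [← hab]; ring
      rw [e]
      exact dvd_sub (Dvd.dvd.mul_left h _) (Dvd.dvd.mul_right h1 _)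
    have : q ∣ p := by exact_mod_cast this
    exact hqp ((Nat.prime_dvd_prime_iff_eq hq hp).1 this)

lemma bq_hensel {p q : ℕ} (hp : p.Prime) (hq : q.Prime) (hq2 : q ≠ 2) (hqp : q ≠ p) (a b x y : ℤ)
    (hab : a ^ 2 + b ^ 2 = p) (hco : IsCoprime a b) (j : ℕ) (hj : 1 ≤ j)
    (hx : (q : ℤ) ^ j ∣ bqF a b x) (hy : (q : ℤ) ^ j ∣ bqF a b y) (hxy : (q : ℤ) ∣ x - y) :
    (q : ℤ) ^ j ∣ x - y := by
  have hqZ : Prime (q : ℤ) := Nat.prime_iff_prime_int.1 hq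
  have hn := bq_not_dvd hp hq hq2 hqp a b x hab ((dvd_pow_self _ (by omega)).trans hx)
  have h := bq_lift a b x y _ hco hx hy
  have hd : ¬ (q : ℤ) ∣ 4 * (x * y + 1) * ((x * y + 1) ^ 2 - (x - y) ^ 2) := by
    intro h1
    have hR : ¬ (q : ℤ) ∣ x * y + 1 := by
      intro h2
      apply hn
      have : x ^ 2 + 1 = (x * y + 1) + (x - y) * x := by ring
      rw [this]
      exact dvd_add h2 (Dvd.dvd.mul_right hxy _)
    rcases hqZ.dvd_or_dvd h1 with h1 | h1
    · rcases hqZ.dvd_or_dvd h1 with h1 | h1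
      · have h2 : (q : ℤ) ∣ 2 := by
          have : (q : ℤ) ∣ 2 ^ 2 := by norm_num; exact h1
          exact hqZ.dvd_of_dvd_pow this
        have : q ∣ 2 := by exact_mod_cast h2
        exact hq2 ((Nat.prime_dvd_prime_iff_eq hq Nat.prime_two).1 this)
      · exact hR h1
    · apply hR
      apply hqZ.dvd_of_dvd_pow (n := 2)
      have : (x * y + 1) ^ 2 = ((x * y + 1) ^ 2 - (x - y) ^ 2) + (x - y) * (x - y) := by ring
      rw [this]
      exact dvd_add h1 (Dvd.dvd.mul_right hxy _)
  exact hqZ.pow_dvd_of_dvd_mul_left j hd h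

lemma bq_card_class (s : Finset ℕ) (T m : ℕ) (hs : s ⊆ Finset.range T)
    (h : ∀ t ∈ s, ∀ u ∈ s, (m : ℤ) ∣ (t : ℤ) - u) : s.card ≤ T / m + 1 := by
  rw [← Finset.card_range (T / m + 1)]
  apply Finset.card_le_card_of_injOn (fun t => t / m)
  · intro t ht
    have := Finset.mem_range.1 (hs ht)
    simp only [Finset.coe_range, Set.mem_Iio]
    exact Nat.lt_succ_of_le (Nat.div_le_div_right this.le)
  · intro t ht u hu htu
    have h1 : t ≡ u [MOD m] := by
      rw [Nat.modEq_iff_dvd]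
      exact h u hu t ht
    have h1' : t % m = u % m := h1
    have htu' : t / m = u / m := htu
    rw [← Nat.div_add_mod t m, ← Nat.div_add_mod u m, h1', htu']

lemma bq_count_odd {p q : ℕ} (hp : p.Prime) (hq : q.Prime) (hq2 : q ≠ 2) (hqp : q ≠ p) (a b : ℤ)
    (hab : a ^ 2 + b ^ 2 = p) (hco : IsCoprime a b) (j : ℕ) (hj : 1 ≤ j) (T : ℕ) (s : Finset ℕ)
    (hs : s ⊆ Finset.range T) (h : ∀ t ∈ s, (q : ℤ) ^ j ∣ bqF a b (2 * t)) :
    (s.card : ℝ) ≤ 4 * (T / (q : ℝ) ^ j + 1) := by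
  have : Fact q.Prime := ⟨hq⟩
  have hqZ : Prime (q : ℤ) := Nat.prime_iff_prime_int.1 hq
  have h2n : ¬ (q : ℤ) ∣ 2 := by
    intro h2
    have : q ∣ 2 := by exact_mod_cast h2
    exact hq2 ((Nat.prime_dvd_prime_iff_eq hq Nat.prime_two).1 this)
  let f : ℕ → ZMod q := fun t => ((2 * t : ℤ) : ZMod q)
  have him : (s.image f).card ≤ 4 := by
    apply bq_roots (a : ZMod q) (b : ZMod q) 0
    · by_contra hcon
      push Not at hcon
      obtain ⟨h1, h3⟩ := hcon
      have h4 : (q : ℤ) ∣ 4 * a := by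
        rw [← ZMod.intCast_zmod_eq_zero_iff_dvd]
        push_cast; exact h3
      have h5 : (q : ℤ) ∣ b := by
        rw [← ZMod.intCast_zmod_eq_zero_iff_dvd]
        exact h1
      have h6 : (q : ℤ) ∣ a := by
        refine (hqZ.dvd_or_dvd h4).resolve_left ?_
        intro h7
        exact h2n (hqZ.dvd_of_dvd_pow (n := 2) (by norm_num; exact h7))
      exact hqZ.not_isUnit (hco.isUnit_of_dvd' h6 h5)
    · intro x hx
      obtain ⟨t, ht, rfl⟩ := Finset.mem_image.1 hx
      have h1 : (q : ℤ) ∣ bqF a b (2 * t) := (dvd_pow_self _ (by omega)).trans (h t ht)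
      rw [← ZMod.intCast_zmod_eq_zero_iff_dvd] at h1
      unfold bqF at h1
      simp only [f]
      push_cast at h1 ⊢
      exact h1
  have hfib : s.card ≤ (T / q ^ j + 1) * (s.image f).card := by
    apply Finset.card_le_mul_card_image
    intro c _
    apply bq_card_class _ T (q ^ j)
    · exact (Finset.filter_subset _ _).trans hs
    · intro t ht u hu
      rw [Finset.mem_filter] at ht hu
      have h3 : (q : ℤ) ∣ 2 * (t : ℤ) - 2 * u := by
        rw [← ZMod.intCast_zmod_eq_zero_iff_dvd, Int.cast_sub, sub_eq_zero]
        exact ht.2.trans hu.2.symm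
      have h4 := bq_hensel hp hq hq2 hqp a b _ _ hab hco j hj (h t ht.1) (h u hu.1) h3
      rw [← mul_sub] at h4
      push_cast
      exact hqZ.pow_dvd_of_dvd_mul_left j h2n h4
  have h1 : s.card ≤ (T / q ^ j + 1) * 4 := hfib.trans (Nat.mul_le_mul_left _ him)
  have h2 : ((T / q ^ j : ℕ) : ℝ) ≤ T / (q : ℝ) ^ j := by
    have := @Nat.cast_div_le ℝ _ _ _ T (q ^ j)
    push_cast at this; exact this
  have h3 : (s.card : ℝ) ≤ ((T / q ^ j : ℕ) + 1) * 4 := by exact_mod_cast h1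
  linarith

lemma bq_count_two (a b : ℤ) (hco : IsCoprime a b) (j : ℕ) (T : ℕ) (s : Finset ℕ)
    (hs : s ⊆ Finset.range T) (h : ∀ t ∈ s, (2 : ℤ) ^ j ∣ bqF a b (2 * t)) :
    (s.card : ℝ) ≤ 8 * (T / (2 : ℝ) ^ j + 1) := by
  have h1 : s.card ≤ T / 2 ^ (j - 3) + 1 := by
    apply bq_card_class s T (2 ^ (j - 3)) hs
    intro t ht u hu
    have h2 := bq_lift a b _ _ _ hco (h t ht) (h u hu)
    have hodd : ¬ (2 : ℤ) ∣ (2 * t * (2 * u) + 1) * ((2 * t * (2 * u) + 1) ^ 2 - (2 * t - 2 * u) ^ 2) := by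
      have : ((2 * t * (2 * u) + 1) * ((2 * t * (2 * u) + 1) ^ 2 - (2 * t - 2 * u) ^ 2) : ℤ)
        = 2 * (32 * t^3 * u^3 + 24 * t^2*u^2 + 6 * t * u - 2 * (t-u)^2 * (4 * t * u + 1)) + 1 := by ring
      rw [this]; omega
    have h3 : (2 : ℤ) ^ j ∣ 2 ^ 3 * ((t : ℤ) - u) := by
      apply Int.prime_two.pow_dvd_of_dvd_mul_left j hodd
      refine h2.trans (dvd_of_eq ?_)
      ring
    push_cast
    rcases le_or_gt j 3 with hj | hj
    · rw [Nat.sub_eq_zero_of_le hj]; simp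
    · have : (2 : ℤ) ^ j = 2 ^ 3 * 2 ^ (j - 3) := by rw [← pow_add]; congr 1; omega
      rw [this] at h3
      exact Int.dvd_of_mul_dvd_mul_left (by norm_num) h3
  have h2 : ((T / 2 ^ (j - 3) : ℕ) : ℝ) ≤ T / (2 : ℝ) ^ (j - 3) := by
    have := @Nat.cast_div_le ℝ _ _ _ T (2 ^ (j - 3))
    push_cast at this; exact this
  have h3 : (s.card : ℝ) ≤ ((T / 2 ^ (j - 3) : ℕ) + 1) := by exact_mod_cast h1
  have h4 : (T : ℝ) / (2 : ℝ) ^ (j - 3) ≤ 8 * (T / 2 ^ j) := by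
    rw [div_le_iff₀ (by positivity)]
    have h5 : (2 : ℝ) ^ j ≤ 8 * 2 ^ (j - 3) := by
      rw [show (8 : ℝ) = 2 ^ 3 by norm_num, ← pow_add]
      exact pow_le_pow_right₀ (by norm_num) (by omega)
    have h6 : (T : ℝ) = T / 2 ^ j * 2 ^ j := by field_simp
    calc (T : ℝ) = T / 2 ^ j * 2 ^ j := h6
      _ ≤ T / 2 ^ j * (8 * 2 ^ (j - 3)) := by gcongr
      _ = _ := by ring
  linarith

lemma bq_count_p {p : ℕ} (hp : p.Prime) (hp2 : p ≠ 2) (a b : ℤ)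
    (hab : a ^ 2 + b ^ 2 = p) (hco : IsCoprime a b) (T : ℕ) (s : Finset ℕ)
    (hs : s ⊆ Finset.range T) (h : ∀ t ∈ s, (p : ℤ) ∣ bqF a b (2 * t)) :
    s.card ≤ T / p + 1 := by
  have hpZ : Prime (p : ℤ) := Nat.prime_iff_prime_int.1 hp
  have h2n : ¬ (p : ℤ) ∣ 2 := by
    intro h2
    have : p ∣ 2 := by exact_mod_cast h2
    exact hp2 ((Nat.prime_dvd_prime_iff_eq hp Nat.prime_two).1 this)
  have hb : ¬ (p : ℤ) ∣ b := by
    intro hb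
    have ha : (p : ℤ) ∣ a := by
      apply hpZ.dvd_of_dvd_pow (n := 2)
      have : a ^ 2 = p - b * b := by rw [← hab]; ring
      rw [this]
      exact dvd_sub dvd_rfl (Dvd.dvd.mul_right hb _)
    exact hpZ.not_isUnit (hco.isUnit_of_dvd' ha hb)
  have key : ∀ t ∈ s, (p : ℤ) ∣ b * (2 * t) - a := by
    intro t ht
    apply hpZ.dvd_of_dvd_pow (n := 4)
    have : (b * (2 * t) - a) ^ 4 = (a ^ 2 + b ^ 2) *
        (6 * b ^ 2 * (2 * t) ^ 2 - 4 * a * b * (2 * t) + a ^ 2 - b ^ 2)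
        - b ^ 3 * bqF a b (2 * t) := by unfold bqF; ring
    rw [this, hab]
    exact dvd_sub (dvd_mul_right _ _) (Dvd.dvd.mul_left (h t ht) _)
  apply bq_card_class s T p hs
  intro t ht u hu
  have h1 := dvd_sub (key t ht) (key u hu)
  have h2 : b * (2 * t) - a - (b * (2 * u) - a) = b * (2 * ((t : ℤ) - u)) := by ring
  rw [h2] at h1
  exact (hpZ.dvd_or_dvd ((hpZ.dvd_or_dvd h1).resolve_left hb)).resolve_left h2n

lemma bq_count_small (a b : ℤ) (hb : b ≠ 0) (M : ℕ) (s : Finset ℕ)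
    (h : ∀ t ∈ s, (bqF a b (2 * t)).natAbs ≤ M) : s.card ≤ 4 * (2 * M + 1) := by
  have h1 : s.card ≤ 4 * (s.image (fun t : ℕ => bqF a b (2 * t))).card := by
    apply Finset.card_le_mul_card_image
    intro c _
    have hinj : Function.Injective (fun t : ℕ => (2 * t : ℤ)) := by
      intro t u htu
      simp only at htu
      omega
    rw [← Finset.card_image_of_injective _ hinj]
    apply bq_roots a b c (Or.inl hb)
    intro x hx
    obtain ⟨t, ht, rfl⟩ := Finset.mem_image.1 hx
    exact (Finset.mem_filter.1 ht).2
  have h2 : (s.image (fun t : ℕ => bqF a b (2 * t))).card ≤ (Finset.Icc (-(M : ℤ)) M).card := by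
    apply Finset.card_le_card
    intro c hc
    obtain ⟨t, ht, rfl⟩ := Finset.mem_image.1 hc
    have := h t ht
    rw [Finset.mem_Icc]
    omega
  rw [Int.card_Icc] at h2
  omega

lemma bq_geom (q : ℝ) (hq : 1 < q) (J : ℕ) : ∑ j ∈ Finset.Icc 1 J, 1 / q ^ j ≤ 1 / (q - 1) := by
  have h : ∑ j ∈ Finset.Icc 1 J, 1 / q ^ j = (1 - 1 / q ^ J) / (q - 1) := by
    have h1 : q - 1 ≠ 0 := by linarith
    have h0 : q ≠ 0 := by linarith
    induction J with
    | zero => simp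
    | succ n ih =>
      rw [Finset.sum_Icc_succ_top (by omega), ih]
      field_simp
      ring
  rw [h]
  apply div_le_div_of_nonneg_right _ (by linarith)
  have : 0 ≤ 1 / q ^ J := by positivity
  linarith

lemma bq_val (q : ℕ) (hq : q.Prime) (A : Finset ℕ) (f : ℕ → ℕ) (N : ℝ) (T c : ℝ) (hT : 0 ≤ T) (hc : 0 ≤ c)
    (hN : 1 ≤ N) (hf0 : ∀ t ∈ A, f t ≠ 0) (hfN : ∀ t ∈ A, (f t : ℝ) ≤ N)
    (h : ∀ j, 1 ≤ j → ((A.filter (fun t => q ^ j ∣ f t)).card : ℝ) ≤ c * (T / (q : ℝ) ^ j + 1)) :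
    ∑ t ∈ A, ((f t).factorization q : ℝ) * Real.log q ≤
      c * (T * (Real.log q / ((q : ℝ) - 1)) + Real.log N) := by
  have hq1 : (1 : ℝ) < q := by exact_mod_cast hq.one_lt
  have hlq : 0 < Real.log q := Real.log_pos hq1
  set J := ⌊Real.log N / Real.log q⌋₊ with hJ
  have hJl : (J : ℝ) * Real.log q ≤ Real.log N := by
    have := Nat.floor_le (div_nonneg (Real.log_nonneg hN) hlq.le)
    rwa [le_div_iff₀ hlq] at this
  have h1 : ∀ t ∈ A, ((f t).factorization q : ℝ) ≤
      ∑ j ∈ Finset.Icc 1 J, if q ^ j ∣ f t then (1 : ℝ) else 0 := by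
    intro t ht
    rw [Finset.sum_boole]
    have h2 : (f t).factorization q ≤ J := by
      apply Nat.le_floor
      rw [le_div_iff₀ hlq, ← Real.log_pow]
      apply Real.log_le_log (by positivity)
      refine le_trans ?_ (hfN t ht)
      exact_mod_cast Nat.le_of_dvd (Nat.pos_of_ne_zero (hf0 t ht)) (Nat.ordProj_dvd (f t) q)
    have h3 : Finset.Icc 1 ((f t).factorization q) ⊆ (Finset.Icc 1 J).filter (fun j => q ^ j ∣ f t) := by
      intro j hj
      rw [Finset.mem_Icc] at hj
      rw [Finset.mem_filter, Finset.mem_Icc]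
      exact ⟨⟨hj.1, hj.2.trans h2⟩, (pow_dvd_pow q hj.2).trans (Nat.ordProj_dvd (f t) q)⟩
    have := Finset.card_le_card h3
    rw [Nat.card_Icc, Nat.add_sub_cancel] at this
    exact_mod_cast this
  have h4 : ∑ t ∈ A, ((f t).factorization q : ℝ) ≤ c * (T * (1 / ((q : ℝ) - 1)) + J) := by
    calc ∑ t ∈ A, ((f t).factorization q : ℝ)
        ≤ ∑ t ∈ A, ∑ j ∈ Finset.Icc 1 J, (if q ^ j ∣ f t then (1 : ℝ) else 0) := Finset.sum_le_sum h1
      _ = ∑ j ∈ Finset.Icc 1 J, ((A.filter (fun t => q ^ j ∣ f t)).card : ℝ) := by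
          rw [Finset.sum_comm]
          simp only [Finset.sum_boole]
      _ ≤ ∑ j ∈ Finset.Icc 1 J, c * (T * (1 / (q : ℝ) ^ j) + 1) := by
          apply Finset.sum_le_sum
          intro j hj
          refine (h j (Finset.mem_Icc.1 hj).1).trans (le_of_eq ?_)
          ring
      _ = c * (T * ∑ j ∈ Finset.Icc 1 J, (1 / (q : ℝ) ^ j) + J) := by
          rw [← Finset.mul_sum, Finset.sum_add_distrib, ← Finset.mul_sum]
          simp
      _ ≤ _ := by
          gcongr
          exact bq_geom q hq1 J
  rw [← Finset.sum_mul]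
  calc (∑ t ∈ A, ((f t).factorization q : ℝ)) * Real.log q
      ≤ c * (T * (1 / ((q : ℝ) - 1)) + J) * Real.log q := by gcongr
    _ = c * (T * (Real.log q / ((q : ℝ) - 1)) + J * Real.log q) := by ring
    _ ≤ _ := by gcongr

lemma bq_log_eq (n : ℕ) (S : Finset ℕ) (hS : n.primeFactors ⊆ S) :
    Real.log n = ∑ q ∈ S, (n.factorization q : ℝ) * Real.log q := by
  rw [Real.log_nat_eq_sum_factorization, Finsupp.sum]
  apply Finset.sum_subset
  · rwa [Nat.support_factorization]
  · intro x _ hx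
    rw [Finsupp.notMem_support_iff.1 hx]; simp

lemma bq_mertens (Y : ℕ) (hY : 1 ≤ Y) :
    ∑ q ∈ Nat.primesLE Y, Real.log q / q ≤ Real.log Y + Real.log 4 := by
  have hY0 : (0 : ℝ) < Y := by exact_mod_cast hY
  have h1 : Real.log (Nat.factorial Y) ≤ Y * Real.log Y := by
    rw [← Real.log_pow]
    apply Real.log_le_log (by exact_mod_cast Nat.factorial_pos Y)
    exact_mod_cast Nat.factorial_le_pow Y
  have h2 : Real.log (Nat.factorial Y) = ∑ q ∈ Nat.primesLE Y, ((Nat.factorial Y).factorization q : ℝ) * Real.log q := by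
    apply bq_log_eq
    intro q hq
    rw [Nat.mem_primesLE]
    have hqp := Nat.prime_of_mem_primeFactors hq
    exact ⟨(hqp.dvd_factorial).1 (Nat.dvd_of_mem_primeFactors hq), hqp⟩
  have h3 : (∑ q ∈ Nat.primesLE Y, Real.log q / q) * Y ≤
      ∑ q ∈ Nat.primesLE Y, ((Nat.factorial Y).factorization q : ℝ) * Real.log q + ∑ q ∈ Nat.primesLE Y, Real.log q := by
    rw [Finset.sum_mul, ← Finset.sum_add_distrib]
    apply Finset.sum_le_sum
    intro q hq
    obtain ⟨hqY, hqp⟩ := Nat.mem_primesLE.1 hq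
    have hq0 : (0 : ℝ) < q := by exact_mod_cast hqp.pos
    have hl : 0 ≤ Real.log q := Real.log_nonneg (by exact_mod_cast hqp.one_le)
    have h4 : Y / q ≤ (Nat.factorial Y).factorization q := by
      rw [Nat.factorization_factorial hqp (b := Nat.log q Y + 2) (by omega)]
      have := Finset.single_le_sum (f := fun i => Y / q ^ i) (s := Finset.Ico 1 (Nat.log q Y + 2))
        (fun _ _ => Nat.zero_le _) (a := 1) (by rw [Finset.mem_Ico]; omega)
      simpa using this
    have h5 : (Y : ℝ) / q ≤ (Nat.factorial Y).factorization q + 1 := by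
      rw [div_le_iff₀ hq0]
      have h6 : Y < (Y / q + 1) * q := by
        have := Nat.lt_div_mul_add (a := Y) hqp.pos
        linarith
      have h7 : Y ≤ ((Nat.factorial Y).factorization q + 1) * q :=
        h6.le.trans (Nat.mul_le_mul_right _ (by omega))
      exact_mod_cast h7
    calc Real.log q / q * Y = Y / q * Real.log q := by ring
      _ ≤ ((Nat.factorial Y).factorization q + 1) * Real.log q := by gcongr
      _ = _ := by ring
  have h8 : ∑ q ∈ Nat.primesLE Y, Real.log q ≤ Real.log 4 * Y := by
    rw [← Chebyshev.theta_eq_sum_primesLE_log]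
    exact Chebyshev.theta_le_log4_mul_x hY0.le
  rw [← h2] at h3
  have h9 : (∑ q ∈ Nat.primesLE Y, Real.log q / q) * Y ≤ (Real.log Y + Real.log 4) * Y := by linarith
  exact le_of_mul_le_mul_right h9 hY0

lemma bq_sum_log (S : Finset ℕ) (hS : ∀ q ∈ S, q.Prime) (Y : ℕ) (hY : 3 ≤ Y) (hc : S.card ≤ Y) :
    ∑ q ∈ S, Real.log q / ((q : ℝ) - 1) ≤ 5 / 2 * Real.log Y + 7 := by
  have hY0 : (0 : ℝ) < Y := by exact_mod_cast (by omega : 0 < Y)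
  have hlY : 0 ≤ Real.log Y := Real.log_nonneg (by exact_mod_cast (by omega : 1 ≤ Y))
  have h1 : ∀ q ∈ S, Real.log q / ((q : ℝ) - 1) ≤ 5 / 4 * (Real.log q / q) + if q ≤ 4 then 1 else 0 := by
    intro q hq
    have hqp := hS q hq
    have hq2 : (2 : ℝ) ≤ q := by exact_mod_cast hqp.two_le
    have hl : 0 ≤ Real.log q := Real.log_nonneg (by linarith)
    split_ifs with h4
    · have h5 : Real.log q / ((q : ℝ) - 1) ≤ 1 := by
        rw [div_le_one (by linarith)]
        exact Real.log_le_sub_one_of_pos (by linarith)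
      have : 0 ≤ 5 / 4 * (Real.log q / q) := by positivity
      linarith
    · have h5 : (5 : ℝ) ≤ q := by exact_mod_cast (by omega : 5 ≤ q)
      rw [add_zero, div_le_iff₀ (by linarith)]
      have h6 : 5 / 4 * (Real.log q / q) * (q - 1) = Real.log q * (5 / 4 * (q - 1) / q) := by ring
      rw [h6]
      have h7 : 1 ≤ 5 / 4 * ((q : ℝ) - 1) / q := by
        rw [le_div_iff₀ (by linarith)]; linarith
      nlinarith
  have h2 : ∑ q ∈ S, (if q ≤ 4 then (1 : ℝ) else 0) ≤ 3 := by
    rw [Finset.sum_boole]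
    have : S.filter (fun q => q ≤ 4) ⊆ {2, 3, 4} := by
      intro q hq
      rw [Finset.mem_filter] at hq
      have := (hS q hq.1).two_le
      simp only [Finset.mem_insert, Finset.mem_singleton]
      omega
    have := Finset.card_le_card this
    have h3 : (S.filter (fun q => q ≤ 4)).card ≤ 3 := this.trans (by decide)
    exact_mod_cast h3
  have h3 : ∑ q ∈ S, Real.log q / (q : ℝ) ≤ 2 * Real.log Y + Real.log 4 := by
    rw [← Finset.sum_filter_add_sum_filter_not S (fun q => q ≤ Y)]
    have h4 : ∑ q ∈ S.filter (fun q => q ≤ Y), Real.log q / (q : ℝ) ≤ Real.log Y + Real.log 4 := by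
      refine le_trans (Finset.sum_le_sum_of_subset_of_nonneg ?_ ?_) (bq_mertens Y (by omega))
      · intro q hq
        rw [Finset.mem_filter] at hq
        exact Nat.mem_primesLE.2 ⟨hq.2, hS q hq.1⟩
      · intro q _ _
        positivity
    have h5 : ∑ q ∈ S.filter (fun q => ¬ q ≤ Y), Real.log q / (q : ℝ) ≤ Real.log Y := by
      have h6 : ∀ q ∈ S.filter (fun q => ¬ q ≤ Y), Real.log q / (q : ℝ) ≤ Real.log Y / Y := by
        intro q hq
        rw [Finset.mem_filter] at hq
        have hY3 : (3 : ℝ) ≤ Y := by exact_mod_cast hY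
        have hqY : (Y : ℝ) ≤ q := by exact_mod_cast (by omega : Y ≤ q)
        have he := Real.exp_one_lt_d9
        exact Real.log_div_self_antitoneOn (by simp only [Set.mem_Ici]; linarith)
          (by simp only [Set.mem_Ici]; linarith) hqY
      refine (Finset.sum_le_card_nsmul _ _ _ h6).trans ?_
      rw [nsmul_eq_mul]
      have h7 : ((S.filter (fun q => ¬ q ≤ Y)).card : ℝ) ≤ Y := by
        exact_mod_cast (Finset.card_filter_le _ _).trans hc
      calc ((S.filter (fun q => ¬ q ≤ Y)).card : ℝ) * (Real.log Y / Y) ≤ Y * (Real.log Y / Y) := by gcongr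
        _ = _ := by field_simp
    linarith
  have h4 : Real.log 4 ≤ 3 := by
    have := Real.log_le_sub_one_of_pos (x := 4) (by norm_num)
    linarith
  calc ∑ q ∈ S, Real.log q / ((q : ℝ) - 1) ≤ _ := Finset.sum_le_sum h1
    _ = 5 / 4 * ∑ q ∈ S, (Real.log q / (q : ℝ)) + ∑ q ∈ S, (if q ≤ 4 then (1 : ℝ) else 0) := by
      rw [Finset.sum_add_distrib, ← Finset.mul_sum]
    _ ≤ _ := by linarith

lemma bq_total {p : ℕ} (hp : p.Prime) (a b : ℤ) (hab : a ^ 2 + b ^ 2 = p) (hco : IsCoprime a b)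
    (T : ℕ) (A S : Finset ℕ) (N : ℝ) (Y : ℕ) (hY : 3 ≤ Y) (hN : 1 ≤ N)
    (hA : A ⊆ Finset.range T) (hS : ∀ q ∈ S, q.Prime) (hpS : p ∉ S) (hSY : S.card ≤ Y)
    (hf0 : ∀ t ∈ A, (bqF a b (2 * t)).natAbs ≠ 0)
    (hfN : ∀ t ∈ A, ((bqF a b (2 * t)).natAbs : ℝ) ≤ N)
    (hfS : ∀ t ∈ A, (bqF a b (2 * t)).natAbs.primeFactors ⊆ S) :
    ∑ t ∈ A, Real.log ((bqF a b (2 * t)).natAbs : ℝ) ≤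
      4 * (T * (5 / 2 * Real.log Y + 7) + Y * Real.log N) + 4 * (T + Real.log N) := by
  have hlN := Real.log_nonneg hN
  have hdv : ∀ q j t : ℕ, q ^ j ∣ (bqF a b (2 * t)).natAbs → (q : ℤ) ^ j ∣ bqF a b (2 * t) := by
    intro q j t h
    have := Int.natCast_dvd.2 h
    push_cast at this
    exact this
  set X : ℕ → ℝ := fun q => T * (Real.log q / ((q : ℝ) - 1)) + Real.log N with hX
  have h1 : ∀ q ∈ S, ∑ t ∈ A, ((bqF a b (2 * t)).natAbs.factorization q : ℝ) * Real.log q ≤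
      4 * X q + if q = 2 then 4 * (T + Real.log N) else 0 := by
    intro q hq
    have hqp := hS q hq
    by_cases hq2 : q = 2
    · subst hq2
      rw [if_pos rfl]
      have := bq_val 2 hqp A (fun t => (bqF a b (2 * t)).natAbs) N T 8 (by positivity) (by norm_num) hN hf0 hfN (by
        intro j _
        have := bq_count_two a b hco j T (A.filter (fun t => 2 ^ j ∣ (bqF a b (2 * t)).natAbs))
          ((Finset.filter_subset _ _).trans hA)
          (fun t ht => by simpa using hdv 2 j t (Finset.mem_filter.1 ht).2)
        simpa using this)
      refine this.trans ?_
      have hl2 : Real.log (2 : ℕ) / (((2 : ℕ) : ℝ) - 1) ≤ 1 := by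
        have := Real.log_le_sub_one_of_pos (x := 2) (by norm_num)
        norm_num at this ⊢
        exact this
      have : (T : ℝ) * (Real.log (2 : ℕ) / (((2 : ℕ) : ℝ) - 1)) ≤ T * 1 := by gcongr
      simp only [hX]
      linarith
    · rw [if_neg hq2, add_zero]
      have hqp' : q ≠ p := fun h => hpS (h ▸ hq)
      exact bq_val q hqp A (fun t => (bqF a b (2 * t)).natAbs) N T 4 (by positivity) (by norm_num) hN hf0 hfN (by
        intro j hj
        exact bq_count_odd hp hqp hq2 hqp' a b hab hco j hj T
          (A.filter (fun t => q ^ j ∣ (bqF a b (2 * t)).natAbs))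
          ((Finset.filter_subset _ _).trans hA)
          (fun t ht => hdv q j t (Finset.mem_filter.1 ht).2))
  have h2 : ∑ q ∈ S, X q ≤ T * (5 / 2 * Real.log Y + 7) + Y * Real.log N := by
    simp only [hX]
    rw [Finset.sum_add_distrib, ← Finset.mul_sum, Finset.sum_const, nsmul_eq_mul]
    have : (S.card : ℝ) ≤ Y := by exact_mod_cast hSY
    gcongr
    exact bq_sum_log S hS Y hY hSY
  have h3 : ∑ q ∈ S, (if q = 2 then 4 * (T + Real.log N) else 0) ≤ 4 * (T + Real.log N) := by
    rw [Finset.sum_ite_eq']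
    split_ifs
    · exact le_rfl
    · positivity
  calc ∑ t ∈ A, Real.log ((bqF a b (2 * t)).natAbs : ℝ)
      = ∑ t ∈ A, ∑ q ∈ S, ((bqF a b (2 * t)).natAbs.factorization q : ℝ) * Real.log q :=
        Finset.sum_congr rfl (fun t ht => bq_log_eq _ S (hfS t ht))
    _ = ∑ q ∈ S, ∑ t ∈ A, ((bqF a b (2 * t)).natAbs.factorization q : ℝ) * Real.log q := Finset.sum_comm
    _ ≤ ∑ q ∈ S, (4 * X q + if q = 2 then 4 * (T + Real.log N) else 0) := Finset.sum_le_sum h1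
    _ = 4 * ∑ q ∈ S, X q + ∑ q ∈ S, (if q = 2 then 4 * (T + Real.log N) else 0) := by
        rw [Finset.sum_add_distrib, ← Finset.mul_sum]
    _ ≤ _ := by linarith

lemma bq_size {p : ℕ} (a b : ℤ) (hab : a ^ 2 + b ^ 2 = p) (t : ℕ) (V : ℝ) (hV : 1 ≤ V) (ht : (t : ℝ) ≤ V) :
    ((bqF a b (2 * t)).natAbs : ℝ) ≤ 256 * (Real.sqrt p * V ^ 4) := by
  have hR : (a : ℝ) ^ 2 + (b : ℝ) ^ 2 = p := by exact_mod_cast congrArg (Int.cast : ℤ → ℝ) hab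
  have ha : |(a : ℝ)| ≤ Real.sqrt p := by
    apply Real.abs_le_sqrt; nlinarith [sq_nonneg (b : ℝ)]
  have hb : |(b : ℝ)| ≤ Real.sqrt p := by
    apply Real.abs_le_sqrt; nlinarith [sq_nonneg (a : ℝ)]
  have hs : 0 ≤ Real.sqrt p := Real.sqrt_nonneg _
  have ht0 : (0 : ℝ) ≤ t := by positivity
  have p1 : (t : ℝ) ≤ V ^ 4 := ht.trans (le_self_pow₀ hV (by norm_num))
  have p2 : (t : ℝ) ^ 2 ≤ V ^ 4 := (pow_le_pow_left₀ ht0 ht 2).trans (pow_le_pow_right₀ hV (by norm_num))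
  have p3 : (t : ℝ) ^ 3 ≤ V ^ 4 := (pow_le_pow_left₀ ht0 ht 3).trans (pow_le_pow_right₀ hV (by norm_num))
  have p4 : (t : ℝ) ^ 4 ≤ V ^ 4 := pow_le_pow_left₀ ht0 ht 4
  have p0 : (1 : ℝ) ≤ V ^ 4 := one_le_pow₀ hV
  have e1 : |4 * (2 * (t : ℝ)) ^ 3 - 4 * (2 * t)| ≤ 40 * V ^ 4 := by
    have := pow_nonneg ht0 3
    rw [abs_le]; constructor <;> nlinarith
  have e2 : |(2 * (t : ℝ)) ^ 4 - 6 * (2 * t) ^ 2 + 1| ≤ 41 * V ^ 4 := by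
    have := pow_nonneg ht0 2
    have := pow_nonneg ht0 4
    rw [abs_le]; constructor <;> nlinarith
  rw [Nat.cast_natAbs]
  unfold bqF
  push_cast
  calc |(a : ℝ) * (4 * (2 * (t : ℝ)) ^ 3 - 4 * (2 * t)) - b * ((2 * (t : ℝ)) ^ 4 - 6 * (2 * t) ^ 2 + 1)|
      ≤ |(a : ℝ) * (4 * (2 * (t : ℝ)) ^ 3 - 4 * (2 * t))| + |b * ((2 * (t : ℝ)) ^ 4 - 6 * (2 * t) ^ 2 + 1)| := abs_sub _ _
    _ ≤ Real.sqrt p * (40 * V ^ 4) + Real.sqrt p * (41 * V ^ 4) := by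
        rw [abs_mul, abs_mul]
        gcongr
    _ ≤ _ := by
        have : 0 ≤ Real.sqrt p * V ^ 4 := by positivity
        linarith

/-- The main counting argument, for a fixed prime `p`, with `P = p ^ (ε / 50)` large. -/
lemma bq_main (ε : ℝ) (hε : 0 < ε) (p : ℕ) (hp : p.Prime) (hp4 : p % 4 = 1) (hp100 : 100 ≤ p)
    (hP1 : Real.exp 60 ≤ (p : ℝ) ^ (ε / 50)) (hP2 : 100 * (25 / ε + 50) ≤ (p : ℝ) ^ (ε / 50)) :
    (p : ℝ) ^ (ε / 50) <
        Nat.card {q : ℕ | q.Prime ∧ Odd q ∧ (q : ℝ) < (p : ℝ) ^ ((1 : ℝ) / 2 + ε) ∧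
          ∃ x : ℤ, x ^ 4 ≡ (-1) ^ ((q - 1) / 2) * (q : ℤ) [ZMOD (p : ℤ)]} := by
  by_contra hcon
  rw [not_lt] at hcon
  set G := {q : ℕ | q.Prime ∧ Odd q ∧ (q : ℝ) < (p : ℝ) ^ ((1 : ℝ) / 2 + ε) ∧
          ∃ x : ℤ, x ^ 4 ≡ (-1) ^ ((q - 1) / 2) * (q : ℤ) [ZMOD (p : ℤ)]} with hG
  have hGfin : G.Finite := by
    apply Set.Finite.subset (Set.finite_Iio (⌈(p : ℝ) ^ ((1 : ℝ) / 2 + ε)⌉₊))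
    intro q hq
    exact Nat.lt_ceil.2 hq.2.2.1
  set P := (p : ℝ) ^ (ε / 50) with hPd
  have hp0 : (0 : ℝ) < p := by exact_mod_cast hp.pos
  have hPbig : (61 : ℝ) ≤ P := by
    have := Real.add_one_le_exp (60 : ℝ)
    linarith
  have hP0 : 0 < P := by linarith
  set l := Real.log P with hl
  have hl60 : 60 ≤ l := by
    rw [hl, Real.le_log_iff_exp_le hP0]; exact hP1
  have hlP : l ≤ P := (Real.log_le_sub_one_of_pos hP0).trans (by linarith)
  have hlp : l = ε / 50 * Real.log p := by rw [hl, hPd, Real.log_rpow hp0]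
  set N := (p : ℝ) ^ ((1 : ℝ) / 2 + ε) with hNd
  have hNP : N = Real.sqrt p * P ^ 50 := by
    rw [hNd, hPd, Real.rpow_add hp0, Real.sqrt_eq_rpow, ← Real.rpow_natCast, ← Real.rpow_mul hp0.le]
    congr 2
    push_cast
    field_simp
  have hlN : Real.log N = (25 / ε + 50) * l := by
    rw [hNd, Real.log_rpow hp0, hlp]
    field_simp
    ring
  have hN1 : 1 ≤ N := by
    rw [hNd]
    apply Real.one_le_rpow _ (by positivity)
    exact_mod_cast hp.one_le
  obtain ⟨a, b, hab, hrec⟩ := bq_recip p hp hp4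
  have hpZ : Prime (p : ℤ) := Nat.prime_iff_prime_int.1 hp
  have hco : IsCoprime a b := by
    rw [Int.isCoprime_iff_gcd_eq_one]
    by_contra hne
    obtain ⟨r, hr, hrd⟩ := Nat.exists_prime_and_dvd hne
    obtain ⟨a', ha'⟩ := (Int.natCast_dvd_natCast.2 hrd).trans (Int.gcd_dvd_left a b)
    obtain ⟨b', hb'⟩ := (Int.natCast_dvd_natCast.2 hrd).trans (Int.gcd_dvd_right a b)
    have h1 : (p : ℤ) = r ^ 2 * (a' ^ 2 + b' ^ 2) := by rw [← hab, ha', hb']; ring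
    have h2 : r ^ 2 ∣ p := by
      have : ((r ^ 2 : ℕ) : ℤ) ∣ p := ⟨_, by push_cast; exact h1⟩
      exact_mod_cast this
    have h3 : r = p := (Nat.prime_dvd_prime_iff_eq hr hp).1 ((dvd_pow_self r (by norm_num)).trans h2)
    rw [h3] at h2
    have := Nat.le_of_dvd hp.pos h2
    nlinarith [hp.two_le]
  have hb0 : b ≠ 0 := by
    rintro rfl
    have h1 : (p : ℤ) ∣ a ^ 2 := ⟨1, by rw [← hab]; ring⟩
    obtain ⟨c, hc⟩ := hpZ.dvd_of_dvd_pow h1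
    have h2 : (p : ℤ) * (p * c ^ 2) = p * 1 := by rw [mul_one]; conv_rhs => rw [← hab, hc]
                                                  ring
    have h3 := mul_left_cancel₀ hpZ.ne_zero h2
    exact hpZ.not_isUnit (IsUnit.of_mul_eq_one _ h3)
  set T := ⌊P ^ 12⌋₊ with hT
  have hTle : (T : ℝ) ≤ P ^ 12 := Nat.floor_le (by positivity)
  have hTlt : P ^ 12 < T + 1 := Nat.lt_floor_add_one _
  have hP12 : P ^ 2 * 1000 ≤ P ^ 12 := by
    have h1 : (1000 : ℝ) ≤ P ^ 10 := by
      calc (1000 : ℝ) ≤ 61 ^ 10 := by norm_num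
        _ ≤ P ^ 10 := by gcongr
    calc P ^ 2 * 1000 ≤ P ^ 2 * P ^ 10 := by gcongr
      _ = P ^ 12 := by ring
  have hP2big : 3600 ≤ P ^ 2 := by nlinarith
  have hThalf : P ^ 12 / 2 ≤ T := by linarith
  have hTbig : (1000 : ℝ) ≤ T := by linarith
  set M := T / 1000 with hM
  -- the good arguments
  set A := (Finset.range T).filter
    (fun t : ℕ => M < (bqF a b (2 * t)).natAbs ∧ ¬ (p : ℤ) ∣ bqF a b (2 * t)) with hA
  have hAcard : 95 / 100 * (T : ℝ) ≤ A.card := by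
    have c1 := bq_count_small a b hb0 M
      ((Finset.range T).filter (fun t : ℕ => (bqF a b (2 * t)).natAbs ≤ M))
      (fun t ht => (Finset.mem_filter.1 ht).2)
    have c2 := bq_count_p hp (by omega) a b hab hco T
      ((Finset.range T).filter (fun t : ℕ => (p : ℤ) ∣ bqF a b (2 * t)))
      (Finset.filter_subset _ _) (fun t ht => (Finset.mem_filter.1 ht).2)
    have c3 : Finset.range T ⊆ A ∪
        ((Finset.range T).filter (fun t : ℕ => (bqF a b (2 * t)).natAbs ≤ M) ∪
        (Finset.range T).filter (fun t : ℕ => (p : ℤ) ∣ bqF a b (2 * t))) := by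
      intro t ht
      simp only [hA, Finset.mem_union, Finset.mem_filter, ht, true_and]
      by_cases h1 : (bqF a b (2 * t)).natAbs ≤ M
      · exact Or.inr (Or.inl h1)
      · by_cases h2 : (p : ℤ) ∣ bqF a b (2 * t)
        · exact Or.inr (Or.inr h2)
        · exact Or.inl ⟨not_le.1 h1, h2⟩
    have c4 := (Finset.card_le_card c3).trans ((Finset.card_union_le _ _).trans
      (Nat.add_le_add_left (Finset.card_union_le _ _) _))
    rw [Finset.card_range] at c4
    have c5 : T / p ≤ T / 100 := Nat.div_le_div_left hp100 (by norm_num)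
    have c6 : (1000 : ℕ) ≤ T := by exact_mod_cast hTbig
    have c7 : 95 * T ≤ 100 * A.card := by omega
    have c8 : (95 : ℝ) * T ≤ 100 * A.card := by exact_mod_cast c7
    linarith
  have hsize : ∀ t ∈ A, ((bqF a b (2 * t)).natAbs : ℝ) < N := by
    intro t ht
    have h1 : (t : ℝ) ≤ P ^ 12 := by
      have : t ≤ T := (Finset.mem_range.1 (Finset.mem_filter.1 ht).1).le
      exact le_trans (by exact_mod_cast this) hTle
    refine (bq_size a b hab t (P ^ 12) (by nlinarith) h1).trans_lt ?_
    rw [hNP]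
    have h2 : 0 < Real.sqrt p * (P ^ 12) ^ 4 := by positivity
    calc 256 * (Real.sqrt p * (P ^ 12) ^ 4) < P ^ 2 * (Real.sqrt p * (P ^ 12) ^ 4) := by
          apply mul_lt_mul_of_pos_right _ h2; linarith
      _ = _ := by ring
  set S := insert 2 (hGfin.toFinset.erase p) with hS
  have hGcard : (hGfin.toFinset.card : ℝ) ≤ P := by
    rw [Nat.card_coe_set_eq, Set.ncard_eq_toFinset_card _ hGfin] at hcon
    exact hcon
  set Y := ⌊P⌋₊ + 1 with hY
  have hY3 : 3 ≤ Y := by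
    have : 2 ≤ ⌊P⌋₊ := Nat.le_floor (by push_cast; linarith)
    omega
  have hYle : (Y : ℝ) ≤ P + 1 := by
    have := Nat.floor_le hP0.le
    rw [hY]; push_cast; linarith
  have hSY : S.card ≤ Y := by
    have h1 : hGfin.toFinset.card ≤ ⌊P⌋₊ := Nat.le_floor hGcard
    have h2 := Finset.card_insert_le 2 (hGfin.toFinset.erase p)
    have h3 := Finset.card_erase_le (s := hGfin.toFinset) (a := p)
    rw [hS, hY]
    omega
  have hSp : ∀ q ∈ S, q.Prime := by
    intro q hq
    rcases Finset.mem_insert.1 hq with rfl | hq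
    · exact Nat.prime_two
    · exact ((Set.Finite.mem_toFinset hGfin).1 (Finset.mem_of_mem_erase hq)).1
  have hpS : p ∉ S := by
    intro h
    rcases Finset.mem_insert.1 h with h | h
    · omega
    · exact (Finset.notMem_erase p _) h
  have htot := bq_total hp a b hab hco T A S N Y hY3 hN1 (Finset.filter_subset _ _) hSp hpS hSY
    (fun t ht => by
      have := (Finset.mem_filter.1 ht).2.1
      omega)
    (fun t ht => (hsize t ht).le)
    (by
      intro t ht q hq
      have hqp := Nat.prime_of_mem_primeFactors hq
      have hqd := Nat.dvd_of_mem_primeFactors hq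
      have hqdZ : (q : ℤ) ∣ bqF a b (2 * t) := Int.natCast_dvd.2 hqd
      have hqp' : q ≠ p := by
        rintro rfl
        exact (Finset.mem_filter.1 ht).2.2 hqdZ
      rw [hS, Finset.mem_insert]
      by_cases hq2 : q = 2
      · exact Or.inl hq2
      · right
        rw [Finset.mem_erase, Set.Finite.mem_toFinset]
        refine ⟨hqp', hqp, hqp.odd_of_ne_two hq2, ?_, hrec q hqp hq2 hqp' _ hqdZ⟩
        refine lt_of_le_of_lt ?_ (hsize t ht)
        exact_mod_cast Nat.le_of_dvd (Nat.pos_of_mem_primeFactors hq |> fun _ => by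
          have := (Finset.mem_filter.1 ht).2.1
          omega) hqd)
  have hT0 : (0 : ℝ) < T := by linarith
  -- lower bound
  have hlogT : 12 * l - 1 ≤ Real.log T := by
    have h1 : Real.log (P ^ 12 / 2) ≤ Real.log T := Real.log_le_log (by positivity) hThalf
    rw [Real.log_div (by positivity) (by norm_num), Real.log_pow] at h1
    have h2 := Real.log_le_sub_one_of_pos (x := 2) (by norm_num)
    push_cast at h1
    linarith
  have hl1000 : Real.log 1000 ≤ 10 := by
    have : Real.log 1000 ≤ Real.log (2 ^ 10) := Real.log_le_log (by norm_num) (by norm_num)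
    rw [Real.log_pow] at this
    have h2 := Real.log_le_sub_one_of_pos (x := 2) (by norm_num)
    push_cast at this
    linarith
  have hlow : ∀ t ∈ A, 12 * l - 11 ≤ Real.log ((bqF a b (2 * t)).natAbs : ℝ) := by
    intro t ht
    have h1 : (T : ℝ) / 1000 ≤ ((bqF a b (2 * t)).natAbs : ℝ) := by
      have h2 := (Finset.mem_filter.1 ht).2.1
      have h3 : T ≤ 1000 * (bqF a b (2 * t)).natAbs := by omega
      have h4 : (T : ℝ) ≤ 1000 * ((bqF a b (2 * t)).natAbs : ℝ) := by exact_mod_cast h3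
      linarith
    have h2 := Real.log_le_log (by positivity) h1
    rw [Real.log_div (by positivity) (by norm_num)] at h2
    linarith
  have hL : 95 / 100 * (T : ℝ) * (12 * l - 11) ≤ ∑ t ∈ A, Real.log ((bqF a b (2 * t)).natAbs : ℝ) := by
    have := Finset.card_nsmul_le_sum A _ _ hlow
    rw [nsmul_eq_mul] at this
    refine le_trans ?_ this
    exact mul_le_mul_of_nonneg_right hAcard (by linarith)
  -- upper bound
  have hlY : Real.log Y ≤ l + 1 := by
    have h1 : (Y : ℝ) ≤ 2 * P := by linarith
    have h2 := Real.log_le_log (by exact_mod_cast (by omega : 0 < Y)) h1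
    rw [Real.log_mul (by norm_num) hP0.ne'] at h2
    have h3 := Real.log_le_sub_one_of_pos (x := 2) (by norm_num)
    linarith
  have hD : 4 * (Y * Real.log N) + 4 * Real.log N ≤ T := by
    have hD0 : 0 ≤ 25 / ε + 50 := by positivity
    have h0 : Real.log N ≤ P * P := by
      rw [hlN]
      have : 25 / ε + 50 ≤ P := by linarith
      gcongr
    have h1 : (0 : ℝ) ≤ Y := by positivity
    calc 4 * (Y * Real.log N) + 4 * Real.log N = 4 * (Y + 1) * Real.log N := by ring
      _ ≤ 4 * (2 * P) * (P * P) := by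
          have : (Y : ℝ) + 1 ≤ 2 * P := by linarith
          have := Real.log_nonneg hN1
          gcongr
      _ = 8 * P ^ 3 := by ring
      _ ≤ P ^ 12 / 2 := by
          have h3 : (16 : ℝ) ≤ P ^ 9 := by
            calc (16 : ℝ) ≤ 61 ^ 9 := by norm_num
              _ ≤ P ^ 9 := by gcongr
          have : P ^ 3 * 16 ≤ P ^ 3 * P ^ 9 := by gcongr
          have h4 : P ^ 3 * P ^ 9 = P ^ 12 := by ring
          linarith
      _ ≤ T := hThalf
  have hTY : (T : ℝ) * (5 / 2 * Real.log Y + 7) ≤ T * (5 / 2 * (l + 1) + 7) := by gcongr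
  have hfin : 95 / 100 * (T : ℝ) * (12 * l - 11) ≤ T * (4 * (5 / 2 * (l + 1) + 7) + 5) := by
    linarith
  have hfin2 : (T : ℝ) * (95 / 100 * (12 * l - 11)) ≤ T * (4 * (5 / 2 * (l + 1) + 7) + 5) := by
    linarith
  have := le_of_mul_le_mul_left hfin2 hT0
  linarith

/-- For every ε > 0 there is a bound p₀(ε) such that for every prime p ≡ 1 (mod 4)
with p > p₀(ε), the number of odd primes q < p^(1/2+ε) for which
q* = (-1)^((q-1)/2) · q is a biquadratic residue modulo p exceeds p^(ε/50). -/
theorem many_small_prime_biquadratic_residues (ε : ℝ) (hε : 0 < ε) :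
    ∃ p₀ : ℕ, ∀ p : ℕ, p.Prime → p % 4 = 1 → p₀ < p →
      (p : ℝ) ^ (ε / 50) <
        Nat.card {q : ℕ | q.Prime ∧ Odd q ∧ (q : ℝ) < (p : ℝ) ^ ((1 : ℝ) / 2 + ε) ∧
          ∃ x : ℤ, x ^ 4 ≡ (-1) ^ ((q - 1) / 2) * (q : ℤ) [ZMOD (p : ℤ)]} := by
  have ht : Filter.Tendsto (fun n : ℕ => (n : ℝ) ^ (ε / 50)) Filter.atTop Filter.atTop :=
    (tendsto_rpow_atTop (by positivity)).comp tendsto_natCast_atTop_atTop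
  have he := ((ht.eventually_ge_atTop (Real.exp 60)).and
    (ht.eventually_ge_atTop (100 * (25 / ε + 50)))).and (Filter.eventually_ge_atTop 100)
  obtain ⟨p₀, h⟩ := Filter.eventually_atTop.1 he
  refine ⟨p₀, fun p hp hp4 hlt => ?_⟩
  obtain ⟨⟨h1, h2⟩, h3⟩ := h p hlt.le
  exact bq_main ε hε p hp hp4 h3 h1 h2
end
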